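/- Assume the ellipticity conditions η₂ < η₁ < η₃ and η₂ + η₃ > 2η₁, and let ē ∈ ℰ with ē ∉ K₃. Then for every ν ∈ (0,1) there exist ε₀ > 0, c_ν > 0 and C₁ > 0 such that for every ε ∈ (0, ε₀), every u in the admissible class with mean strain ē, every measurable ℤ³-periodic χ: ℝ³ → K₃, and all total-variation bounds S₁, S₂, S₃ for the indicator functions χ₁, χ₂, χ₃ respectively, one has ∫_{[0,1]³} |e(u) − χ|² dx + ε(S₁ + S₂ + S₃) ≥ C₁ exp(−c_ν |log ε|^{1/2 + ν}). -/

import Mathlib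

open Matrix MeasureTheory

noncomputable section

/-- Three-dimensional Euclidean space. -/
abbrev V3 : Type := EuclideanSpace ℝ (Fin 3)

/-- Build a Euclidean vector from its coordinates. -/
def vec3 (f : Fin 3 → ℝ) : V3 := (WithLp.equiv 2 (Fin 3 → ℝ)).symm f

/-- The three wells `e⁽¹⁾ = diag(η₃, η₁, η₂)`, `e⁽²⁾ = diag(η₂, η₃, η₁)`,
`e⁽³⁾ = diag(η₁, η₂, η₃)` (0-indexed). -/
def well3 (η₁ η₂ η₃ : ℝ) : Fin 3 → Matrix (Fin 3) (Fin 3) ℝ :=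
  ![Matrix.diagonal ![η₃, η₁, η₂], Matrix.diagonal ![η₂, η₃, η₁], Matrix.diagonal ![η₁, η₂, η₃]]

/-- The set `K₃ = {e⁽¹⁾, e⁽²⁾, e⁽³⁾}`. -/
def K3 (η₁ η₂ η₃ : ℝ) : Set (Matrix (Fin 3) (Fin 3) ℝ) :=
  {well3 η₁ η₂ η₃ 0, well3 η₁ η₂ η₃ 1, well3 η₁ η₂ η₃ 2}

/-- The auxiliary matrices `J₁ = diag(κ, η₁, η₁)`, `J₂ = diag(η₁, κ, η₁)`,
`J₃ = diag(η₁, η₁, κ)` with `κ = η₂ + η₃ - η₁` (0-indexed). -/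
def Jmat3 (η₁ η₂ η₃ : ℝ) : Fin 3 → Matrix (Fin 3) (Fin 3) ℝ :=
  ![Matrix.diagonal ![η₂ + η₃ - η₁, η₁, η₁],
    Matrix.diagonal ![η₁, η₂ + η₃ - η₁, η₁],
    Matrix.diagonal ![η₁, η₁, η₂ + η₃ - η₁]]

/-- The set `ℰ = conv{J₁,J₂,J₃} ∪ ⋃ⱼ [Jⱼ, e⁽ʲ⁾]`. -/
def Eset3 (η₁ η₂ η₃ : ℝ) : Set (Matrix (Fin 3) (Fin 3) ℝ) :=
  convexHull ℝ {Jmat3 η₁ η₂ η₃ 0, Jmat3 η₁ η₂ η₃ 1, Jmat3 η₁ η₂ η₃ 2} ∪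
    ⋃ j : Fin 3, segment ℝ (Jmat3 η₁ η₂ η₃ j) (well3 η₁ η₂ η₃ j)

/-- The symmetrized gradient `e(u)(x) = (1/2)(∇u(x) + ∇u(x)ᵀ)`, expressed via `fderiv`
(which, by Rademacher's theorem, exists a.e. for Lipschitz `u`). -/
def symGrad3 (u : V3 → V3) (x : V3) : Matrix (Fin 3) (Fin 3) ℝ := fun i j =>
  (fderiv ℝ u x (EuclideanSpace.single j 1) i + fderiv ℝ u x (EuclideanSpace.single i 1) j) / 2

/-- The unit cube `[0,1]³`. -/
def cube3 : Set V3 := {x | ∀ i, 0 ≤ x i ∧ x i ≤ 1}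

/-- The point of `ℝ³` corresponding to a lattice point `n ∈ ℤ³`. -/
def zlat (n : Fin 3 → ℤ) : V3 := vec3 fun i => (n i : ℝ)

/-- `ℤ³`-periodicity. -/
def ZPer {α : Type*} (f : V3 → α) : Prop := ∀ (x : V3) (n : Fin 3 → ℤ), f (x + zlat n) = f x

/-- `S` is a total-variation bound for the periodic function `f`: the dual (BV) formulation
of the BV seminorm on the torus. -/
def IsTVBound (f : V3 → ℝ) (S : ℝ) : Prop :=
  ∀ φ : V3 → V3, ContDiff ℝ (⊤ : ℕ∞) φ → ZPer φ → (∀ x, ‖φ x‖ ≤ 1) →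
    (∫ x in cube3, f x * ∑ i, fderiv ℝ φ x (EuclideanSpace.single i 1) i) ≤ S

/-- The indicator function of the phase `j`, i.e. of `{x : χ x = e⁽ʲ⁾}`. -/
def indic3 (η₁ η₂ η₃ : ℝ) (χ : V3 → Matrix (Fin 3) (Fin 3) ℝ) (j : Fin 3) : V3 → ℝ :=
  Set.indicator {x | χ x = well3 η₁ η₂ η₃ j} fun _ => (1 : ℝ)

/-- `u` belongs to the admissible class with mean strain `ē`:
`u(x) = (ē + s)x + v(x)` with `s` skew-symmetric and `v` Lipschitz and `ℤ³`-periodic. -/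
def Admissible (ebar : Matrix (Fin 3) (Fin 3) ℝ) (u : V3 → V3) : Prop :=
  ∃ s : Matrix (Fin 3) (Fin 3) ℝ, sᵀ = -s ∧
    ∃ (v : V3 → V3) (K : NNReal), LipschitzWith K v ∧ ZPer v ∧
      u = fun x => vec3 ((ebar + s).mulVec fun i => x i) + v x

local instance : MeasureSpace UnitAddCircle := ⟨AddCircle.haarAddCircle⟩

local instance : Measure.IsAddHaarMeasure (volume : Measure UnitAddCircle) :=
  inferInstanceAs (Measure.IsAddHaarMeasure AddCircle.haarAddCircle)

local instance : IsProbabilityMeasure (volume : Measure UnitAddCircle) :=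
  inferInstanceAs (IsProbabilityMeasure AddCircle.haarAddCircle)

@[simp] lemma vec3_apply (f : Fin 3 → ℝ) (i : Fin 3) : vec3 f i = f i := rfl

@[simp] lemma zlat_apply (n : Fin 3 → ℤ) (i : Fin 3) : zlat n i = n i := rfl

/-- The representative in `(0,1]³` of a point of the torus. -/
def torusRep (θ : UnitAddTorus (Fin 3)) : V3 :=
  vec3 fun i => (AddCircle.equivIoc 1 0 (θ i)).1

lemma measurable_torusRep : Measurable torusRep := by
  have h : Measurable fun θ : UnitAddTorus (Fin 3) =>
      (fun i => (AddCircle.equivIoc (1 : ℝ) 0 (θ i)).1 : Fin 3 → ℝ) :=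
    measurable_pi_lambda _ fun i =>
      measurable_subtype_coe.comp ((AddCircle.measurableEquivIoc 1 0).measurable.comp
        (measurable_pi_apply i))
  exact (MeasurableEquiv.toLp 2 (Fin 3 → ℝ)).measurable.comp h

lemma coe_torusRep (θ : UnitAddTorus (Fin 3)) (i : Fin 3) :
    ((torusRep θ i : ℝ) : UnitAddCircle) = θ i := by
  simp only [torusRep, vec3_apply]
  exact (AddCircle.equivIoc 1 0).symm_apply_apply (θ i)

lemma torusRep_coe_of_mem {x : Fin 3 → ℝ} (hx : ∀ i, x i ∈ Set.Ioc (0 : ℝ) (0 + 1)) :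
    torusRep (fun i => (x i : UnitAddCircle)) = vec3 x := by
  ext i
  simp only [torusRep, vec3_apply]
  have := (AddCircle.equivIoc 1 0).apply_symm_apply ⟨x i, hx i⟩
  exact congrArg Subtype.val this

lemma ZPer.torusRep_add {α : Type*} {f : V3 → α} (hf : ZPer f) (θ : UnitAddTorus (Fin 3))
    (a : V3) : f (torusRep (fun i => θ i + (a i : UnitAddCircle))) = f (torusRep θ + a) := by
  have h : ∀ i, ∃ n : ℤ,
      torusRep (fun i => θ i + (a i : UnitAddCircle)) i = torusRep θ i + a i + n := by
    intro i
    have h1 : ((torusRep (fun i => θ i + (a i : UnitAddCircle)) i : ℝ) : UnitAddCircle)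
        = ((torusRep θ i + a i : ℝ) : UnitAddCircle) := by
      rw [coe_torusRep, AddCircle.coe_add, coe_torusRep]
    obtain ⟨n, hn⟩ := AddSubgroup.mem_zmultiples_iff.1 (QuotientAddGroup.eq_iff_sub_mem.1 h1)
    exact ⟨n, by simp at hn; linarith⟩
  choose n hn using h
  rw [← hf (torusRep θ + a) n]
  congr 1
  ext i
  simp [hn i]

/-- Integrals over the unit cube are integrals over the torus. -/
lemma integral_cube3 {E : Type*} [NormedAddCommGroup E] [NormedSpace ℝ E] (f : V3 → E) :
    ∫ x in cube3, f x = ∫ θ : UnitAddTorus (Fin 3), f (torusRep θ) := by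
  rw [UnitAddTorus.integral_preimage _ (0 : Fin 3 → ℝ)]
  have h1 : ∫ x in {x : Fin 3 → ℝ | ∀ i, x i ∈ Set.Ioc ((0 : Fin 3 → ℝ) i) ((0 : Fin 3 → ℝ) i + 1)},
      f (torusRep fun i => (x i : UnitAddCircle))
      = ∫ x in {x : Fin 3 → ℝ | ∀ i, x i ∈ Set.Ioc (0 : ℝ) (0 + 1)}, f (vec3 x) := by
    refine setIntegral_congr_fun (MeasurableSet.univ_pi' (fun i => measurableSet_Ioc)) ?_
    intro x hx
    simp only
    rw [torusRep_coe_of_mem hx]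
  rw [h1]
  have hmp := (EuclideanSpace.volume_preserving_symm_measurableEquiv_toLp (Fin 3)).symm
  have h2 := hmp.setIntegral_preimage_emb (MeasurableEquiv.measurableEmbedding _) f cube3
  rw [← h2]
  have h3 : (Set.Icc (0 : Fin 3 → ℝ) 1) =ᵐ[volume]
      {x : Fin 3 → ℝ | ∀ i, x i ∈ Set.Ioc (0 : ℝ) (0 + 1)} := by
    have := (Measure.univ_pi_Ioc_ae_eq_Icc (μ := fun _ : Fin 3 => (volume : Measure ℝ))
      (f := (0 : Fin 3 → ℝ)) (g := 1)).symm
    have hset : (Set.univ.pi fun i => Set.Ioc ((0 : Fin 3 → ℝ) i) ((1 : Fin 3 → ℝ) i))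
        = {x : Fin 3 → ℝ | ∀ i, x i ∈ Set.Ioc (0 : ℝ) (0 + 1)} := by
      ext x
      simp
    rwa [hset] at this
  rw [← setIntegral_congr_set h3]
  have h4 : (Set.Icc (0 : Fin 3 → ℝ) 1)
      = (MeasurableEquiv.toLp 2 (Fin 3 → ℝ)) ⁻¹' cube3 := by
    ext x
    simp [cube3, Pi.le_def, forall_and]
  rw [h4]
  rfl

/-- Translation invariance of integrals of periodic functions. -/
lemma integral_cube3_add {E : Type*} [NormedAddCommGroup E] [NormedSpace ℝ E] {f : V3 → E}
    (hf : ZPer f) (a : V3) : ∫ x in cube3, f (x + a) = ∫ x in cube3, f x := by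
  rw [integral_cube3, integral_cube3]
  simp_rw [← hf.torusRep_add]
  exact integral_add_right_eq_self (μ := (volume : Measure (UnitAddTorus (Fin 3))))
    (fun θ => f (torusRep θ)) (fun i => (a i : UnitAddCircle))

/-- The character `x ↦ exp (-2πi k·x)`. -/
def char3 (k : Fin 3 → ℤ) (x : V3) : ℂ :=
  Complex.exp (-(2 * Real.pi * Complex.I * ∑ i, (k i : ℂ) * (x i : ℂ)))

/-- Fourier coefficients of a `ℤ³`-periodic function. -/
def fc (f : V3 → ℝ) (k : Fin 3 → ℤ) : ℂ := ∫ x in cube3, char3 k x * (f x : ℂ)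

lemma char3_torusRep (k : Fin 3 → ℤ) (θ : UnitAddTorus (Fin 3)) :
    char3 k (torusRep θ) = UnitAddTorus.mFourier (-k) θ := by
  simp only [UnitAddTorus.mFourier, ContinuousMap.coe_mk, char3]
  conv_rhs => enter [2, i]; rw [← coe_torusRep θ i, fourier_coe_apply]
  rw [← Complex.exp_sum]
  congr 1
  rw [Finset.mul_sum, ← Finset.sum_neg_distrib]
  refine Finset.sum_congr rfl fun i _ => ?_
  simp
  ring

lemma hasSum_fc_sq {f : V3 → ℝ} (hf : Measurable f) {C : ℝ} (hC : ∀ x, |f x| ≤ C) :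
    HasSum (fun k => ‖fc f k‖ ^ 2) (∫ x in cube3, f x ^ 2) := by
  set F : UnitAddTorus (Fin 3) → ℂ := fun θ => (f (torusRep θ) : ℂ) with hF
  have hmeas : Measurable F := Complex.measurable_ofReal.comp (hf.comp measurable_torusRep)
  have hmem : MemLp F 2 (volume : Measure (UnitAddTorus (Fin 3))) :=
    MemLp.of_bound hmeas.aestronglyMeasurable C (Filter.Eventually.of_forall fun θ => by
      simpa [hF] using hC _)
  have key := UnitAddTorus.hasSum_sq_mFourierCoeff (hmem.toLp F)
  have hco : ∀ k, UnitAddTorus.mFourierCoeff (hmem.toLp F) k = fc f k := by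
    intro k
    rw [fc, integral_cube3, UnitAddTorus.mFourierCoeff]
    refine integral_congr_ae ?_
    filter_upwards [hmem.coeFn_toLp] with θ hθ
    rw [hθ, char3_torusRep, smul_eq_mul]
  simp_rw [hco] at key
  convert key using 1
  rw [integral_cube3]
  refine integral_congr_ae ?_
  filter_upwards [hmem.coeFn_toLp] with θ hθ
  rw [hθ]
  simp [hF]

lemma volume_real_cube3 : volume.real cube3 = 1 := by
  simpa using integral_cube3 (fun _ => (1 : ℝ))

lemma volume_cube3_lt_top : volume cube3 < ⊤ := by
  by_contra h
  have h1 := volume_real_cube3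
  simp [Measure.real, not_lt_top_iff.1 h] at h1

/-- The coordinate vector `t eᵢ`. -/
def axis (i : Fin 3) (t : ℝ) : V3 := EuclideanSpace.single i t

instance : IsFiniteMeasure (volume.restrict cube3) :=
  ⟨by simpa using volume_cube3_lt_top⟩

/-- Bounded measurable functions. -/
def BddMeas (f : V3 → ℝ) : Prop := Measurable f ∧ ∃ C, ∀ x, |f x| ≤ C

namespace BddMeas

variable {f g : V3 → ℝ}

lemma add (hf : BddMeas f) (hg : BddMeas g) : BddMeas fun x => f x + g x := by
  obtain ⟨C, hC⟩ := hf.2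
  obtain ⟨D, hD⟩ := hg.2
  exact ⟨hf.1.add hg.1, C + D, fun x => (abs_add_le _ _).trans (add_le_add (hC x) (hD x))⟩

lemma const_mul (hf : BddMeas f) (c : ℝ) : BddMeas fun x => c * f x := by
  obtain ⟨C, hC⟩ := hf.2
  exact ⟨hf.1.const_mul c, |c| * C, fun x => by
    rw [abs_mul]; exact mul_le_mul_of_nonneg_left (hC x) (abs_nonneg c)⟩

lemma sub (hf : BddMeas f) (hg : BddMeas g) : BddMeas fun x => f x - g x := by
  obtain ⟨C, hC⟩ := hf.2
  obtain ⟨D, hD⟩ := hg.2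
  exact ⟨hf.1.sub hg.1, C + D, fun x => (abs_sub _ _).trans (add_le_add (hC x) (hD x))⟩

lemma mul (hf : BddMeas f) (hg : BddMeas g) : BddMeas fun x => f x * g x := by
  obtain ⟨C, hC⟩ := hf.2
  obtain ⟨D, hD⟩ := hg.2
  exact ⟨hf.1.mul hg.1, C * D, fun x => by
    rw [abs_mul]
    exact mul_le_mul (hC x) (hD x) (abs_nonneg _) ((abs_nonneg _).trans (hC x))⟩

lemma sq (hf : BddMeas f) : BddMeas fun x => f x ^ 2 := by
  simpa [pow_two] using hf.mul hf

lemma const (c : ℝ) : BddMeas fun _ => c := ⟨measurable_const, |c|, fun _ => le_rfl⟩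

lemma comp_add (hf : BddMeas f) (a : V3) : BddMeas fun x => f (x + a) := by
  obtain ⟨C, hC⟩ := hf.2
  exact ⟨hf.1.comp (measurable_id.add_const a), C, fun x => hC _⟩

lemma integrable (hf : BddMeas f) : Integrable f (volume.restrict cube3) := by
  obtain ⟨C, hC⟩ := hf.2
  exact Integrable.of_bound hf.1.aestronglyMeasurable C
    (Filter.Eventually.of_forall fun x => by simpa using hC x)

lemma hasSum_fc (hf : BddMeas f) : HasSum (fun k => ‖fc f k‖ ^ 2) (∫ x in cube3, f x ^ 2) :=
  hasSum_fc_sq hf.1 hf.2.choose_spec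

end BddMeas

lemma norm_char3 (k : Fin 3 → ℤ) (x : V3) : ‖char3 k x‖ = 1 := by
  have : char3 k x = Complex.exp (((-(2 * Real.pi * ∑ i, (k i : ℝ) * x i) : ℝ) : ℂ) * Complex.I) := by
    rw [char3]
    congr 1
    push_cast
    ring
  rw [this, Complex.norm_exp_ofReal_mul_I]

lemma char3_add (k : Fin 3 → ℤ) (x a : V3) : char3 k (x + a) = char3 k x * char3 k a := by
  rw [char3, char3, char3, ← Complex.exp_add]
  congr 1
  simp only [PiLp.add_apply, Complex.ofReal_add, mul_add, Finset.sum_add_distrib]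
  ring

lemma char3_axis (k : Fin 3 → ℤ) (i : Fin 3) (t : ℝ) :
    char3 k (axis i t) = Complex.exp (-(2 * Real.pi * Complex.I * (k i * t))) := by
  rw [char3]
  congr 3
  rw [Finset.sum_eq_single i]
  · simp [axis]
  · intro b _ hb
    simp [axis, hb]
  · simp

lemma neg_axis (i : Fin 3) (t : ℝ) : -axis i t = axis i (-t) := by
  ext j
  by_cases h : j = i <;> simp [axis, h]

lemma measurable_char3 (k : Fin 3 → ℤ) : Measurable (char3 k) := by
  unfold char3
  fun_prop

lemma char3_zlat (k n : Fin 3 → ℤ) : char3 k (zlat n) = 1 := by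
  rw [char3, Complex.exp_eq_one_iff]
  refine ⟨-∑ i, k i * n i, ?_⟩
  push_cast
  simp only [zlat_apply, Complex.ofReal_intCast]
  ring

lemma ZPer_char3 (k : Fin 3 → ℤ) : ZPer (char3 k) := fun x n => by
  rw [char3_add, char3_zlat, mul_one]

lemma ZPer.comp_add {α : Type*} {f : V3 → α} (hf : ZPer f) (a : V3) : ZPer fun x => f (x + a) :=
  fun x n => by
    change f (x + zlat n + a) = f (x + a)
    rw [add_right_comm, hf]

section Fourier

variable {f g : V3 → ℝ}

lemma fc_translate (hf : ZPer f) (a : V3) (k : Fin 3 → ℤ) :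
    fc (fun x => f (x + a)) k = char3 k (-a) * fc f k := by
  have hp : ZPer fun x => char3 k x * (f x : ℂ) := fun x n => by
    simp only [ZPer_char3 k x n, hf x n]
  rw [fc, fc, ← integral_cube3_add hp a, ← integral_const_mul]
  congr 1
  ext x
  have : char3 k x = char3 k (-a) * char3 k (x + a) := by
    rw [mul_comm, ← char3_add, add_neg_cancel_right]
  rw [this, mul_assoc]

lemma BddMeas.integrable_char3_mul (hf : BddMeas f) (k : Fin 3 → ℤ) :
    Integrable (fun x => char3 k x * (f x : ℂ)) (volume.restrict cube3) := by
  obtain ⟨C, hC⟩ := hf.2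
  refine Integrable.of_bound ((measurable_char3 k).mul
    (Complex.measurable_ofReal.comp hf.1)).aestronglyMeasurable C
    (Filter.Eventually.of_forall fun x => ?_)
  simpa [norm_char3] using hC x

lemma fc_sub (hf : BddMeas f) (hg : BddMeas g) (k : Fin 3 → ℤ) :
    fc (fun x => f x - g x) k = fc f k - fc g k := by
  rw [fc, fc, fc, ← integral_sub (hf.integrable_char3_mul k) (hg.integrable_char3_mul k)]
  congr 1
  ext x
  push_cast
  ring

lemma fc_add (hf : BddMeas f) (hg : BddMeas g) (k : Fin 3 → ℤ) :
    fc (fun x => f x + g x) k = fc f k + fc g k := by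
  rw [fc, fc, fc, ← integral_add (hf.integrable_char3_mul k) (hg.integrable_char3_mul k)]
  congr 1
  ext x
  push_cast
  ring

lemma fc_const_mul (c : ℝ) (f : V3 → ℝ) (k : Fin 3 → ℤ) :
    fc (fun x => c * f x) k = c * fc f k := by
  rw [fc, fc, ← integral_const_mul]
  congr 1
  ext x
  push_cast
  ring

lemma fc_zero (f : V3 → ℝ) : fc f 0 = ((∫ x in cube3, f x : ℝ) : ℂ) := by
  rw [fc, ← integral_complex_ofReal]
  simp [char3]

lemma fc_const {k : Fin 3 → ℤ} (hk : k ≠ 0) (c : ℝ) : fc (fun _ => c) k = 0 := by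
  obtain ⟨i, hi⟩ := Function.ne_iff.1 hk
  have hi' : (k i : ℂ) ≠ 0 := by exact_mod_cast hi
  have h := fc_translate (f := fun _ => c) (fun _ _ => rfl) (axis i (1 / (2 * k i))) k
  rw [neg_axis, char3_axis] at h
  have h2 : Complex.exp (-(2 * Real.pi * Complex.I * (k i * ((-(1 / (2 * k i)) : ℝ) : ℂ)))) = -1 := by
    rw [← Complex.exp_pi_mul_I]
    congr 1
    push_cast
    field_simp
  rw [h2] at h
  linear_combination h / 2

/-- The squared modulus of the Fourier multiplier of the difference with step `t`. -/
def diffSq (t : ℝ) (n : ℤ) : ℝ := 2 - 2 * Real.cos (2 * Real.pi * (n * t))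

lemma diffSq_nonneg (t : ℝ) (n : ℤ) : 0 ≤ diffSq t n := by
  have := Real.cos_le_one (2 * Real.pi * (n * t))
  rw [diffSq]; linarith

lemma diffSq_le_four (t : ℝ) (n : ℤ) : diffSq t n ≤ 4 := by
  have := Real.neg_one_le_cos (2 * Real.pi * (n * t))
  rw [diffSq]; linarith

lemma diffSq_le_sq (t : ℝ) (n : ℤ) : diffSq t n ≤ (2 * Real.pi * (n * t)) ^ 2 := by
  have := Real.one_sub_sq_div_two_le_cos (x := 2 * Real.pi * (n * t))
  rw [diffSq]; linarith

lemma norm_char3_axis_sub_one_sq (k : Fin 3 → ℤ) (i : Fin 3) (t : ℝ) :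
    ‖char3 k (-axis i t) - 1‖ ^ 2 = diffSq t (k i) := by
  rw [neg_axis, char3_axis]
  have : -(2 * Real.pi * Complex.I * (k i * ((-t : ℝ) : ℂ)))
      = ((2 * Real.pi * (k i * t) : ℝ) : ℂ) * Complex.I := by push_cast; ring
  rw [this, Complex.exp_mul_I, ← Complex.ofReal_cos, ← Complex.ofReal_sin, ← Complex.normSq_eq_norm_sq,
    Complex.normSq_apply, diffSq]
  simp only [Complex.sub_re, Complex.add_re, Complex.ofReal_re, Complex.mul_re, Complex.I_re,
    Complex.ofReal_im, Complex.I_im, Complex.one_re, Complex.sub_im, Complex.add_im,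
    Complex.mul_im, Complex.one_im]
  nlinarith [Real.sin_sq_add_cos_sq (2 * Real.pi * (k i * t))]

/-- The difference of `f` in direction `eᵢ` with step `t`. -/
def diff (i : Fin 3) (t : ℝ) (f : V3 → ℝ) : V3 → ℝ := fun x => f (x + axis i t) - f x

lemma BddMeas.diff (hf : BddMeas f) (i : Fin 3) (t : ℝ) : BddMeas (diff i t f) :=
  (hf.comp_add _).sub hf

lemma ZPer.diff (hf : ZPer f) (i : Fin 3) (t : ℝ) : ZPer (diff i t f) := fun x n => by
  have := hf.comp_add (axis i t) x n
  simp only at this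
  simp only [_root_.diff, this, hf x n]

lemma norm_fc_diff_sq (hb : BddMeas f) (hf : ZPer f) (i : Fin 3) (t : ℝ) (k : Fin 3 → ℤ) :
    ‖fc (diff i t f) k‖ ^ 2 = diffSq t (k i) * ‖fc f k‖ ^ 2 := by
  have : fc (diff i t f) k = (char3 k (-axis i t) - 1) * fc f k := by
    unfold diff
    rw [fc_sub (hb.comp_add _) hb, fc_translate hf]
    ring
  rw [this, norm_mul, mul_pow, norm_char3_axis_sub_one_sq]

end Fourier

lemma exists_add_zlat_mem_cube3 (x : V3) : ∃ n, x + zlat n ∈ cube3 :=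
  ⟨fun i => -⌊x i⌋, fun i => by
    have h1 := Int.floor_le (x i)
    have h2 := Int.lt_floor_add_one (x i)
    constructor <;> simp <;> linarith⟩

lemma norm_le_of_mem_cube3 {x : V3} (hx : x ∈ cube3) : ‖x‖ ≤ 3 := by
  rw [EuclideanSpace.norm_eq]
  refine Real.sqrt_le_iff.2 ⟨by norm_num, ?_⟩
  rw [Fin.sum_univ_three]
  simp only [Real.norm_eq_abs, sq_abs]
  nlinarith [hx 0, hx 1, hx 2, (hx 0).1, (hx 0).2, (hx 1).1, (hx 1).2, (hx 2).1, (hx 2).2]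

lemma abs_coord_le_norm (x : V3) (i : Fin 3) : |x i| ≤ ‖x‖ := by
  simpa using PiLp.norm_apply_le x i

lemma BddMeas.coord_of_lipschitz {v : V3 → V3} {K : NNReal} (hv : LipschitzWith K v)
    (hp : ZPer v) (i : Fin 3) : BddMeas fun x => v x i := by
  refine ⟨?_, K * 3 + ‖v 0‖, fun x => ?_⟩
  · have := hv.continuous.measurable
    fun_prop
  · obtain ⟨n, hn⟩ := exists_add_zlat_mem_cube3 x
    simp only [← hp x n]
    refine (abs_coord_le_norm _ _).trans ?_
    have h1 := hv.dist_le_mul (x + zlat n) 0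
    rw [dist_eq_norm, dist_zero_right] at h1
    have h2 := norm_le_of_mem_cube3 hn
    have h3 : ‖v (x + zlat n)‖ ≤ ‖v (x + zlat n) - v 0‖ + ‖v 0‖ := by
      simpa using norm_add_le (v (x + zlat n) - v 0) (v 0)
    have h4 : (K : ℝ) * ‖x + zlat n‖ ≤ K * 3 := mul_le_mul_of_nonneg_left h2 K.2
    linarith

/-- The partial derivative `∂ⱼ vᵢ`. -/
def pderiv3 (v : V3 → V3) (i j : Fin 3) (x : V3) : ℝ :=
  fderiv ℝ v x (EuclideanSpace.single j 1) i

lemma BddMeas.pderiv3 {v : V3 → V3} {K : NNReal} (hv : LipschitzWith K v) (i j : Fin 3) :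
    BddMeas (pderiv3 v i j) := by
  refine ⟨?_, K, fun x => ?_⟩
  · have := measurable_fderiv_apply_const ℝ v (EuclideanSpace.single j (1 : ℝ))
    unfold _root_.pderiv3
    fun_prop
  · refine (abs_coord_le_norm _ _).trans ?_
    refine ((fderiv ℝ v x).le_opNorm _).trans ?_
    simpa using norm_fderiv_le_of_lipschitz ℝ hv (x₀ := x)

lemma fc_pderiv3 {v : V3 → V3} {K : NNReal} (hv : LipschitzWith K v) (hp : ZPer v)
    (i j : Fin 3) (k : Fin 3 → ℤ) :
    fc (pderiv3 v i j) k = 2 * Real.pi * Complex.I * k j * fc (fun x => v x i) k := by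
  set t : ℕ → ℝ := fun n => 1 / ((n : ℝ) + 1) with ht
  have ht0 : ∀ n, 0 < t n := fun n => Nat.one_div_pos_of_nat
  have htl : Filter.Tendsto t Filter.atTop (nhdsWithin 0 {0}ᶜ) := by
    refine tendsto_nhdsWithin_iff.2 ⟨tendsto_one_div_add_atTop_nhds_zero_nat, ?_⟩
    exact Filter.Eventually.of_forall fun n => (ht0 n).ne'
  have hb := BddMeas.coord_of_lipschitz hv hp i
  have hpi : ZPer fun x => v x i := fun x n => by simp only [hp x n]
  set c : V3 → ℝ := fun x => v x i with hc
  have h1 : ∀ n, fc (fun x => (t n)⁻¹ * diff j (t n) c x) k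
      = (((t n)⁻¹ : ℝ) : ℂ) * (Complex.exp ((2 * Real.pi * Complex.I * k j) * (t n : ℂ)) - 1) * fc c k := by
    intro n
    rw [fc_const_mul]
    unfold diff
    rw [fc_sub (hb.comp_add _) hb, fc_translate hpi, neg_axis, char3_axis]
    have : -(2 * Real.pi * Complex.I * (k j * ((-t n : ℝ) : ℂ)))
      = (2 * Real.pi * Complex.I * k j) * (t n : ℂ) := by push_cast; ring
    rw [this]
    ring
  have h2 : Filter.Tendsto (fun n => fc (fun x => (t n)⁻¹ * diff j (t n) c x) k) Filter.atTop
      (nhds (2 * Real.pi * Complex.I * k j * fc c k)) := by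
    simp_rw [h1]
    refine Filter.Tendsto.mul_const _ ?_
    have hd : HasDerivAt (fun s : ℝ => Complex.exp ((2 * Real.pi * Complex.I * k j) * (s : ℂ)))
        (2 * Real.pi * Complex.I * k j) 0 := by
      have h := ((hasDerivAt_id (0 : ℂ)).const_mul (2 * Real.pi * Complex.I * k j)).cexp
      have h' := h.comp_ofReal (z := 0)
      simpa using h'
    have := (hasDerivAt_iff_tendsto_slope_zero.1 hd).comp htl
    refine this.congr fun n => ?_
    simp
  refine tendsto_nhds_unique ?_ h2
  refine tendsto_integral_of_dominated_convergence (fun _ => (K : ℝ)) (fun n => ?_)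
    (integrable_const _) (fun n => Filter.Eventually.of_forall fun x => ?_) ?_
  · exact (((hb.diff j (t n)).const_mul (t n)⁻¹).integrable_char3_mul k).aestronglyMeasurable
  · rw [norm_mul, norm_char3, one_mul, Complex.norm_real, norm_mul, norm_inv, Real.norm_eq_abs,
      abs_of_pos (ht0 n), inv_mul_le_iff₀ (ht0 n)]
    have h := hv.dist_le_mul (x + axis j (t n)) x
    rw [dist_eq_norm, dist_eq_norm, add_sub_cancel_left] at h
    have h' : ‖axis j (t n)‖ = t n := by simp [axis, abs_of_pos (ht0 n)]
    rw [h'] at h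
    have h3 := abs_coord_le_norm (v (x + axis j (t n)) - v x) i
    rw [PiLp.sub_apply] at h3
    simp only [diff, hc, Real.norm_eq_abs]
    linarith
  · filter_upwards [ae_restrict_of_ae hv.ae_differentiableAt] with x hx
    refine Filter.Tendsto.const_mul _ ?_
    refine (Complex.continuous_ofReal.tendsto _).comp ?_
    have hd : HasDerivAt (fun s : ℝ => v (x + s • EuclideanSpace.single j (1 : ℝ)) i)
        (pderiv3 v i j x) 0 := by
      have h := (hx.hasFDerivAt.hasLineDerivAt (EuclideanSpace.single j (1 : ℝ)))
      exact (PiLp.hasFDerivAt_apply (𝕜 := ℝ) 2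
        (v (x + (0 : ℝ) • EuclideanSpace.single j (1 : ℝ))) i).comp_hasDerivAt 0 h
    have := (hasDerivAt_iff_tendsto_slope_zero.1 hd).comp htl
    refine this.congr fun n => ?_
    have h' : axis j (t n) = t n • EuclideanSpace.single j (1 : ℝ) := by
      ext l
      by_cases h : l = j <;> simp [axis, h]
    simp [diff, hc, h']

lemma isCompact_cube3 : IsCompact cube3 := by
  refine Metric.isCompact_of_isClosed_isBounded ?_
    (Metric.isBounded_iff_subset_closedBall 0 |>.2 ⟨3, fun x hx => by
      simpa using norm_le_of_mem_cube3 hx⟩)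
  have : cube3 = ⋂ i, {x : V3 | 0 ≤ x i ∧ x i ≤ 1} := by ext; simp [cube3]
  rw [this]
  refine isClosed_iInter fun i => ?_
  have hi : Continuous fun x : V3 => x i := by fun_prop
  exact (isClosed_le continuous_const hi).inter (isClosed_le hi continuous_const)

lemma ZPer.exists_norm_bound {E : Type*} [NormedAddCommGroup E] {f : V3 → E} (hp : ZPer f)
    (hf : Continuous f) : ∃ C, ∀ x, ‖f x‖ ≤ C := by
  obtain ⟨C, hC⟩ := isCompact_cube3.exists_bound_of_continuousOn hf.continuousOn
  refine ⟨C, fun x => ?_⟩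
  obtain ⟨n, hn⟩ := exists_add_zlat_mem_cube3 x
  rw [← hp x n]
  exact hC _ hn

lemma ZPer.fderiv {E : Type*} [NormedAddCommGroup E] [NormedSpace ℝ E] {f : V3 → E}
    (hp : ZPer f) : ZPer (fderiv ℝ f) := fun x n => by
  rw [← fderiv_comp_add_right]
  congr 1
  ext y
  exact hp y n

/-- Testing a difference of `f` against a smooth periodic function bounded by one. -/
lemma IsTVBound.integral_diff_mul_le {f : V3 → ℝ} (hb : BddMeas f) (hp : ZPer f) {S : ℝ}
    (hS : IsTVBound f S) (i : Fin 3) {t : ℝ} (ht : 0 ≤ t) {g : V3 → ℝ}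
    (hg : ContDiff ℝ (⊤ : ℕ∞) g) (hgp : ZPer g) (hg1 : ∀ x, |g x| ≤ 1) :
    ∫ x in cube3, diff i t f x * g x ≤ t * S := by
  have hgb : BddMeas g := ⟨hg.continuous.measurable, 1, hg1⟩
  have hgd : Differentiable ℝ g := hg.differentiable (by simp)
  have hgc : Continuous (fderiv ℝ g) := hg.continuous_fderiv (by simp)
  obtain ⟨C, hC⟩ := hgp.fderiv.exists_norm_bound hgc
  obtain ⟨D, hD⟩ := hb.2
  have hD0 : 0 ≤ D := (abs_nonneg _).trans (hD 0)
  set e : V3 := EuclideanSpace.single i (1 : ℝ) with he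
  have hline : ∀ x : V3, ∀ s : ℝ,
      HasDerivAt (fun s : ℝ => f x * g (x + axis i (-s))) (-(f x * fderiv ℝ g (x + axis i (-s)) e)) s := by
    intro x s
    have h1 : HasDerivAt (fun s : ℝ => x + axis i (-s)) (-e) s := by
      have : (fun s : ℝ => x + axis i (-s)) = fun s => x + s • (-e) := by
        ext s l
        by_cases h : l = i <;> simp [axis, he, h]
      rw [this]
      simpa using ((hasDerivAt_id s).smul_const (-e)).const_add x
    have h2 := ((hgd (x + axis i (-s))).hasFDerivAt.comp_hasDerivAt s h1).const_mul (f x)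
    simpa using h2
  have hder : ∀ s : ℝ, HasDerivAt (fun s : ℝ => ∫ x in cube3, f x * g (x + axis i (-s)))
      (∫ x in cube3, -(f x * fderiv ℝ g (x + axis i (-s)) e)) s := by
    intro s
    refine (hasDerivAt_integral_of_dominated_loc_of_deriv_le (μ := volume.restrict cube3)
      (𝕜 := ℝ) (F := fun s x => f x * g (x + axis i (-s)))
      (F' := fun s x => -(f x * fderiv ℝ g (x + axis i (-s)) e)) (x₀ := s) (s := Set.univ)
      (bound := fun _ => D * C) Filter.univ_mem ?_ ?_ ?_ ?_ ?_ ?_).2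
    · exact Filter.Eventually.of_forall fun s =>
        (hb.mul (hgb.comp_add _)).integrable.aestronglyMeasurable
    · exact (hb.mul (hgb.comp_add _)).integrable
    · have h0 : Continuous fun x => _root_.fderiv ℝ g (x + axis i (-s)) :=
        hgc.comp (by fun_prop)
      have h1 : Measurable fun x => _root_.fderiv ℝ g (x + axis i (-s)) e :=
        (h0.clm_apply continuous_const).measurable
      exact (hb.1.mul h1).neg.aestronglyMeasurable
    · refine Filter.Eventually.of_forall fun x s _ => ?_
      rw [norm_neg, norm_mul]
      refine mul_le_mul (hD x) ?_ (norm_nonneg _) hD0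
      refine ((fderiv ℝ g _).le_opNorm e).trans ?_
      simpa [he] using hC _
    · exact integrable_const _
    · exact Filter.Eventually.of_forall fun x s _ => hline x s
  have hle : ∀ s : ℝ, (∫ x in cube3, -(f x * fderiv ℝ g (x + axis i (-s)) e)) ≤ S := by
    intro s
    have hφ := hS (fun x => axis i (-g (x + axis i (-s)))) ?_ ?_ ?_
    · refine le_of_eq_of_le ?_ hφ
      congr 1
      ext x
      have h1 : HasFDerivAt (fun x => axis i (-g (x + axis i (-s))))
          ((-(fderiv ℝ g (x + axis i (-s)))).smulRight e) x := by
        have h2 : HasFDerivAt (fun x => g (x + axis i (-s))) (fderiv ℝ g (x + axis i (-s))) x :=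
          (hasFDerivAt_comp_add_right (axis i (-s))).2 (hgd _).hasFDerivAt
        have h3 := h2.neg.smul_const e
        have : (fun x => axis i (-g (x + axis i (-s)))) = fun x => (-g (x + axis i (-s))) • e := by
          ext x l
          by_cases h : l = i <;> simp [axis, he, h]
        rw [this]
        exact h3
      rw [h1.fderiv, Finset.sum_eq_single i]
      · simp [he]
      · intro l _ hl
        simp [he, hl]
      · simp
    · have : (fun x => axis i (-g (x + axis i (-s)))) = fun x => (-g (x + axis i (-s))) • e := by
        ext x l
        by_cases h : l = i <;> simp [axis, he, h]
      rw [this]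
      exact ((hg.comp (contDiff_id.add contDiff_const)).neg).smul contDiff_const
    · intro x n
      have := hgp.comp_add (axis i (-s)) x n
      simp only at this
      simp only [this]
    · intro x
      simpa [axis] using hg1 _
  have hmv := image_sub_le_mul_sub_of_deriv_le (fun s => (hder s).differentiableAt)
    (fun s => (hder s).deriv.le.trans (hle s)) ht
  have hq : ZPer fun x => f x * g (x + axis i (-t)) := fun x n => by
    have := hgp.comp_add (axis i (-t)) x n
    simp only at this
    simp only [this, hp x n]
  have e1 := integral_cube3_add hq (axis i t)
  have e2 : ∀ x, x + axis i t + axis i (-t) = x := fun x => by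
    rw [← neg_axis, add_neg_cancel_right]
  have e3 : axis i (-0) = 0 := by simp [axis]
  simp only [e2] at e1
  simp only [e3, add_zero] at hmv
  rw [← e1, ← integral_sub ((hb.comp_add _).mul hgb).integrable (hb.mul hgb).integrable] at hmv
  calc _ = _ := by
        congr 1
        ext x
        rw [diff]
        ring
    _ ≤ _ := hmv
    _ = _ := by ring

lemma IsTVBound.integral_diff_sq_le {f : V3 → ℝ} (hb : BddMeas f) (hp : ZPer f)
    (h01 : ∀ x, 0 ≤ f x ∧ f x ≤ 1) {S : ℝ} (hS : IsTVBound f S) (i : Fin 3) {t : ℝ} (ht : 0 ≤ t) :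
    ∫ x in cube3, diff i t f x ^ 2 ≤ t * S := by
  set w := diff i t f with hw
  have hwb : BddMeas w := hb.diff i t
  have hwp : ZPer w := hp.diff i t
  have hw1 : ∀ x, |w x| ≤ 1 := fun x => by
    have h1 := h01 x
    have h2 := h01 (x + axis i t)
    rw [hw, diff, abs_le]
    constructor <;> linarith
  have hwl : LocallyIntegrable w volume := by
    refine (locallyIntegrable_const (1 : ℝ)).mono hwb.1.aestronglyMeasurable
      (Filter.Eventually.of_forall fun x => by simpa using hw1 x)
  let φ : ℕ → ContDiffBump (0 : V3) := fun n =>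
    ⟨1 / ((n : ℝ) + 1), 2 * (1 / ((n : ℝ) + 1)), Nat.one_div_pos_of_nat, by
      have : (0 : ℝ) < 1 / ((n : ℝ) + 1) := Nat.one_div_pos_of_nat
      linarith⟩
  set g : ℕ → V3 → ℝ := fun n =>
    convolution ((φ n).normed volume) w (ContinuousLinearMap.lsmul ℝ ℝ) volume with hgdef
  have hgc : ∀ n, ContDiff ℝ (⊤ : ℕ∞) (g n) := fun n =>
    (φ n).hasCompactSupport_normed.contDiff_convolution_left _ (φ n).contDiff_normed hwl
  have hgp : ∀ n, ZPer (g n) := fun n x z => by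
    simp only [hgdef, convolution]
    congr 1
    ext y
    rw [add_sub_right_comm, hwp]
  have hg1 : ∀ n x, |g n x| ≤ 1 := fun n x => by
    simp only [hgdef, convolution]
    rw [← Real.norm_eq_abs]
    refine (norm_integral_le_of_norm_le ((φ n).integrable_normed (μ := volume))
      (Filter.Eventually.of_forall fun y => ?_)).trans (φ n).integral_normed.le
    have h0 := (φ n).nonneg_normed (μ := volume) y
    simp only [ContinuousLinearMap.lsmul_apply, smul_eq_mul, norm_mul, Real.norm_eq_abs,
      abs_of_nonneg h0]
    exact mul_le_of_le_one_right h0 (hw1 _)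
  have hlim : Filter.Tendsto (fun n => ∫ x in cube3, w x * g n x) Filter.atTop
      (nhds (∫ x in cube3, w x ^ 2)) := by
    refine tendsto_integral_of_dominated_convergence (fun _ => (1 : ℝ)) (fun n => ?_)
      (integrable_const _) (fun n => Filter.Eventually.of_forall fun x => ?_) ?_
    · exact (hwb.1.mul (hgc n).continuous.measurable).aestronglyMeasurable
    · rw [norm_mul]
      exact mul_le_one₀ (hw1 x) (norm_nonneg _) (hg1 n x)
    · have hae := ContDiffBump.ae_convolution_tendsto_right_of_locallyIntegrable (φ := φ)
        (l := Filter.atTop) (K := 2) (μ := volume) (g := w) ?_ ?_ hwl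
      · filter_upwards [ae_restrict_of_ae hae] with x hx
        rw [pow_two]
        exact hx.const_mul (w x)
      · have h0 := (tendsto_one_div_add_atTop_nhds_zero_nat (𝕜 := ℝ)).const_mul 2
        rw [mul_zero] at h0
        exact h0
      · exact Filter.Eventually.of_forall fun n => le_rfl
  exact le_of_tendsto' hlim fun n =>
    hS.integral_diff_mul_le hb hp i ht (hgc n) (hgp n) (hg1 n)

lemma integral_diffSq_ge {H : ℝ} (n : ℤ) (hn : 1 ≤ H * |(n : ℝ)|) :
    H ≤ ∫ t in (0 : ℝ)..H, diffSq t n := by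
  have hn0 : (n : ℝ) ≠ 0 := by
    rintro h
    rw [h] at hn
    norm_num at hn
  have hc : 2 * Real.pi * (n : ℝ) ≠ 0 := by positivity
  have hcos : ∫ t in (0 : ℝ)..H, Real.cos (2 * Real.pi * n * t)
      = (2 * Real.pi * n)⁻¹ * Real.sin (2 * Real.pi * n * H) := by
    rw [intervalIntegral.integral_comp_mul_left (f := Real.cos) hc]
    simp
  have heq : ∫ t in (0 : ℝ)..H, diffSq t n
      = 2 * H - 2 * ((2 * Real.pi * n)⁻¹ * Real.sin (2 * Real.pi * n * H)) := by
    rw [← hcos, ← intervalIntegral.integral_const_mul]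
    simp only [diffSq, ← mul_assoc]
    rw [intervalIntegral.integral_sub (by simp)
      (Continuous.intervalIntegrable (by fun_prop) _ _)]
    simp [mul_comm]
  have habs : |(2 * Real.pi * n)⁻¹ * Real.sin (2 * Real.pi * n * H)| ≤ H / 2 := by
    rw [abs_mul, abs_inv]
    have h1 := Real.abs_sin_le_one (2 * Real.pi * n * H)
    have h2 : |2 * Real.pi * (n : ℝ)| = 2 * Real.pi * |(n : ℝ)| := by
      rw [abs_mul, abs_of_pos (by positivity)]
    have hn' : 0 < |(n : ℝ)| := abs_pos.2 hn0
    rw [h2, inv_mul_le_iff₀ (by positivity)]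
    nlinarith [Real.pi_gt_three]
  have := (abs_le.1 habs).2
  rw [heq]
  linarith

lemma continuous_diffSq (n : ℤ) : Continuous fun t => diffSq t n := by
  unfold diffSq
  fun_prop

/-- Averaging a bound on finite differences over step sizes controls high frequencies. -/
lemma tsum_indicator_le_of_diffSq {a : (Fin 3 → ℤ) → ℝ} (ha : ∀ k, 0 ≤ a k) (hs : Summable a)
    (i : Fin 3) {H B : ℝ} (hH : 0 < H)
    (hB : ∀ t, 0 ≤ t → t ≤ H → ∑' k, diffSq t (k i) * a k ≤ B) :
    ∑' k, {k : Fin 3 → ℤ | 1 ≤ H * |(k i : ℝ)|}.indicator a k ≤ B := by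
  refine Real.tsum_le_of_sum_le (fun k => Set.indicator_nonneg (fun k _ => ha k) k) fun s => ?_
  have hfin : ∀ t, 0 ≤ t → t ≤ H → ∑ k ∈ s, diffSq t (k i) * a k ≤ B := fun t h0 h1 => by
    refine (Summable.sum_le_tsum s (fun k _ => mul_nonneg (diffSq_nonneg _ _) (ha k)) ?_).trans
      (hB t h0 h1)
    exact Summable.of_nonneg_of_le (fun k => mul_nonneg (diffSq_nonneg _ _) (ha k))
      (fun k => mul_le_mul_of_nonneg_right (diffSq_le_four _ _) (ha k)) (hs.mul_left 4)
  have h_int : ∀ k ∈ s, IntervalIntegrable (fun t => diffSq t (k i) * a k) volume 0 H :=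
    fun k _ => ((continuous_diffSq (k i)).mul continuous_const).intervalIntegrable _ _
  have h1 : ∫ t in (0 : ℝ)..H, ∑ k ∈ s, diffSq t (k i) * a k ≤ ∫ _t in (0 : ℝ)..H, B := by
    refine intervalIntegral.integral_mono_on hH.le 
      (Continuous.intervalIntegrable (continuous_finsetSum _ fun k _ =>
        (continuous_diffSq (k i)).mul continuous_const) _ _) (by simp)
      fun t ht => hfin t ht.1 ht.2
  rw [intervalIntegral.integral_finsetSum h_int, intervalIntegral.integral_const, sub_zero,
    smul_eq_mul] at h1
  have h2 : H * ∑ k ∈ s, {k : Fin 3 → ℤ | 1 ≤ H * |(k i : ℝ)|}.indicator a k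
      ≤ ∑ k ∈ s, ∫ t in (0 : ℝ)..H, diffSq t (k i) * a k := by
    rw [Finset.mul_sum]
    refine Finset.sum_le_sum fun k _ => ?_
    rw [intervalIntegral.integral_mul_const]
    by_cases hk : 1 ≤ H * |(k i : ℝ)|
    · rw [Set.indicator_of_mem (by exact hk)]
      exact mul_le_mul_of_nonneg_right (integral_diffSq_ge _ hk) (ha k)
    · rw [Set.indicator_of_notMem (by exact hk), mul_zero]
      exact mul_nonneg (intervalIntegral.integral_nonneg hH.le fun t _ => diffSq_nonneg _ _) (ha k)
  exact le_of_mul_le_mul_left (h2.trans h1) hH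

lemma Summable.diffSq_mul {a : (Fin 3 → ℤ) → ℝ} (ha : ∀ k, 0 ≤ a k) (hs : Summable a)
    (i : Fin 3) (t : ℝ) : Summable fun k => diffSq t (k i) * a k :=
  Summable.of_nonneg_of_le (fun k => mul_nonneg (diffSq_nonneg _ _) (ha k))
    (fun k => mul_le_mul_of_nonneg_right (diffSq_le_four _ _) (ha k)) (hs.mul_left 4)

lemma tsum_indicator_le_of_diffSq_diffSq {a : (Fin 3 → ℤ) → ℝ} (ha : ∀ k, 0 ≤ a k)
    (hs : Summable a) (i j : Fin 3) {H B : ℝ} (hH : 0 < H)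
    (hB : ∀ t s, 0 ≤ t → t ≤ H → 0 ≤ s → s ≤ H →
      ∑' k, diffSq t (k i) * (diffSq s (k j) * a k) ≤ B) :
    ∑' k, {k : Fin 3 → ℤ | 1 ≤ H * |(k i : ℝ)| ∧ 1 ≤ H * |(k j : ℝ)|}.indicator a k ≤ B := by
  have h1 : ∀ s, 0 ≤ s → s ≤ H →
      ∑' k, diffSq s (k j) * {k : Fin 3 → ℤ | 1 ≤ H * |(k i : ℝ)|}.indicator a k ≤ B :=
    fun s h0 h1 => by
      have := tsum_indicator_le_of_diffSq (fun k => mul_nonneg (diffSq_nonneg s (k j)) (ha k))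
        (Summable.diffSq_mul ha hs j s) i hH fun t h2 h3 => hB t s h2 h3 h0 h1
      refine le_of_eq_of_le (tsum_congr fun k => ?_) this
      by_cases hk : 1 ≤ H * |(k i : ℝ)| <;> simp [Set.indicator, hk]
  have h2 := tsum_indicator_le_of_diffSq (Set.indicator_nonneg fun k _ => ha k)
    (hs.indicator _) j hH h1
  refine le_of_eq_of_le (tsum_congr fun k => ?_) h2
  by_cases hk : 1 ≤ H * |(k i : ℝ)| <;> simp [Set.indicator, hk]

/-- The quantitative relations between the phase spectra `p m = ‖χ̂ₘₘ‖²` and the elastic energy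
density `G` in Fourier space. -/
structure SpectralBounds (p : Fin 3 → (Fin 3 → ℤ) → ℝ) (G : (Fin 3 → ℤ) → ℝ) (C₀ C₁ C₂ : ℝ) :
    Prop where
  nonneg : ∀ m k, 0 ≤ p m k
  summable : ∀ m, Summable (p m)
  energy_nonneg : ∀ k, 0 ≤ G k
  energy_summable : Summable G
  pos₀ : 0 ≤ C₀
  pos₁ : 0 ≤ C₁
  pos₂ : 0 ≤ C₂
  transfer : ∀ i j l m : Fin 3, i ≠ j → j ≠ l → i ≠ l → ∀ t s : ℝ,
    ∑' k, diffSq t (k i) * (diffSq s (k j) * p m k) ≤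
      C₀ * ∑' k, diffSq t (k i) * (diffSq s (k j) * p l k)
  cone : ∀ i j l : Fin 3, i ≠ j → j ≠ l → i ≠ l → ∀ (k : Fin 3 → ℤ) (N : ℝ),
    (∀ a, |(k a : ℝ)| ≤ N) → ((k i : ℝ) * k j) ^ 2 * p l k ≤ C₁ * N ^ 4 * G k
  axial : ∀ i j l : Fin 3, i ≠ j → j ≠ l → i ≠ l → ∀ k : Fin 3 → ℤ, k i ≠ 0 →
    2 * |(k j : ℝ)| ≤ |(k i : ℝ)| → 2 * |(k l : ℝ)| ≤ |(k i : ℝ)| → ∑ m, p m k ≤ C₂ * G k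

/-- The total spectral mass at frequencies of size at least `Λ`. -/
def specTail (p : Fin 3 → (Fin 3 → ℤ) → ℝ) (Λ : ℝ) : ℝ :=
  ∑' k, {k : Fin 3 → ℤ | ∃ i, Λ ≤ |(k i : ℝ)|}.indicator (fun k => ∑ m, p m k) k

namespace SpectralBounds

variable {p : Fin 3 → (Fin 3 → ℤ) → ℝ} {G : (Fin 3 → ℤ) → ℝ} {C₀ C₁ C₂ : ℝ}

lemma sum_nonneg (h : SpectralBounds p G C₀ C₁ C₂) (k : Fin 3 → ℤ) : 0 ≤ ∑ m, p m k :=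
  Finset.sum_nonneg fun m _ => h.nonneg m k

lemma summable_sum (h : SpectralBounds p G C₀ C₁ C₂) : Summable fun k => ∑ m, p m k :=
  _root_.summable_sum fun m _ => h.summable m

lemma specTail_anti (h : SpectralBounds p G C₀ C₁ C₂) {Λ Λ' : ℝ} (hΛ : Λ' ≤ Λ) :
    specTail p Λ ≤ specTail p Λ' := by
  refine Summable.tsum_le_tsum (fun k => ?_) (h.summable_sum.indicator _)
    (h.summable_sum.indicator _)
  exact Set.indicator_le_indicator_of_subset (by
    rintro k ⟨i, hi⟩
    exact ⟨i, hΛ.trans hi⟩)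
    (fun k => h.sum_nonneg k) k

lemma tsum_pair_le (h : SpectralBounds p G C₀ C₁ C₂) (i j l : Fin 3) (hij : i ≠ j) (hjl : j ≠ l)
    (hil : i ≠ l) {H Λ : ℝ} (hH : 0 < H) (hΛ : 0 < Λ) :
    ∑' k, {k : Fin 3 → ℤ | 1 ≤ H * |(k i : ℝ)| ∧ 1 ≤ H * |(k j : ℝ)|}.indicator
      (fun k => ∑ m, p m k) k ≤
      3 * C₀ * (16 * specTail p Λ + (2 * Real.pi) ^ 4 * C₁ * (H * Λ) ^ 4 * ∑' k, G k) := by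
  refine tsum_indicator_le_of_diffSq_diffSq h.sum_nonneg h.summable_sum i j hH
    fun t s ht0 htH hs0 hsH => ?_
  have hsm : ∀ m, Summable fun k => diffSq t (k i) * (diffSq s (k j) * p m k) := fun m =>
    Summable.diffSq_mul (fun k => mul_nonneg (diffSq_nonneg _ _) (h.nonneg m k))
      (Summable.diffSq_mul (h.nonneg m) (h.summable m) j s) i t
  have hl : ∑' k, diffSq t (k i) * (diffSq s (k j) * p l k) ≤
      16 * specTail p Λ + (2 * Real.pi) ^ 4 * C₁ * (H * Λ) ^ 4 * ∑' k, G k := by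
    rw [specTail, ← tsum_mul_left, ← tsum_mul_left,
      ← ((h.summable_sum.indicator _).mul_left 16).tsum_add (h.energy_summable.mul_left _)]
    refine Summable.tsum_le_tsum (fun k => ?_) (hsm l)
      (((h.summable_sum.indicator _).mul_left 16).add (h.energy_summable.mul_left _))
    have hq1 := diffSq_nonneg t (k i)
    have hq2 := diffSq_nonneg s (k j)
    have hp := h.nonneg l k
    by_cases hk : ∃ i, Λ ≤ |(k i : ℝ)|
    · rw [Set.indicator_of_mem (by exact hk)]
      have h3 : p l k ≤ ∑ m, p m k :=
        Finset.single_le_sum (fun m _ => h.nonneg m k) (Finset.mem_univ l)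
      have h4 : diffSq t (k i) * (diffSq s (k j) * p l k) ≤ 4 * (4 * p l k) :=
        mul_le_mul (diffSq_le_four _ _) (mul_le_mul_of_nonneg_right (diffSq_le_four _ _) hp)
          (mul_nonneg hq2 hp) (by norm_num)
      have h5 : 0 ≤ (2 * Real.pi) ^ 4 * C₁ * (H * Λ) ^ 4 * G k :=
        mul_nonneg (mul_nonneg (mul_nonneg (by positivity) h.pos₁) (by positivity))
          (h.energy_nonneg k)
      linarith
    · rw [Set.indicator_of_notMem (by exact hk), mul_zero, zero_add]
      push Not at hk
      have h3 := h.cone i j l hij hjl hil k Λ fun a => (hk a).le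
      have h4 : diffSq t (k i) ≤ (2 * Real.pi) ^ 2 * H ^ 2 * (k i : ℝ) ^ 2 := by
        refine (diffSq_le_sq _ _).trans ?_
        have : t ^ 2 ≤ H ^ 2 := by gcongr
        calc _ = (2 * Real.pi) ^ 2 * t ^ 2 * (k i : ℝ) ^ 2 := by ring
          _ ≤ _ := by gcongr
      have h5 : diffSq s (k j) ≤ (2 * Real.pi) ^ 2 * H ^ 2 * (k j : ℝ) ^ 2 := by
        refine (diffSq_le_sq _ _).trans ?_
        have : s ^ 2 ≤ H ^ 2 := by gcongr
        calc _ = (2 * Real.pi) ^ 2 * s ^ 2 * (k j : ℝ) ^ 2 := by ring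
          _ ≤ _ := by gcongr
      calc diffSq t (k i) * (diffSq s (k j) * p l k)
          ≤ (2 * Real.pi) ^ 2 * H ^ 2 * (k i : ℝ) ^ 2 *
            ((2 * Real.pi) ^ 2 * H ^ 2 * (k j : ℝ) ^ 2 * p l k) := by gcongr
        _ = (2 * Real.pi) ^ 4 * H ^ 4 * (((k i : ℝ) * k j) ^ 2 * p l k) := by ring
        _ ≤ (2 * Real.pi) ^ 4 * H ^ 4 * (C₁ * Λ ^ 4 * G k) := by gcongr
        _ = _ := by ring
  have hsum : ∑' k, diffSq t (k i) * (diffSq s (k j) * ∑ m, p m k) =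
      ∑ m, ∑' k, diffSq t (k i) * (diffSq s (k j) * p m k) := by
    rw [← Summable.tsum_finsetSum fun m _ => hsm m]
    simp only [Finset.mul_sum]
  rw [hsum]
  calc _ ≤ ∑ _m : Fin 3, C₀ * ∑' k, diffSq t (k i) * (diffSq s (k j) * p l k) :=
        Finset.sum_le_sum fun m _ => h.transfer i j l m hij hjl hil t s
    _ = 3 * C₀ * ∑' k, diffSq t (k i) * (diffSq s (k j) * p l k) := by
        simp [mul_assoc]
    _ ≤ _ := mul_le_mul_of_nonneg_left hl (mul_nonneg (by norm_num) h.pos₀)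

/-- Spectral mass at frequency scale `Λ'` is controlled by the mass at the larger scale `Λ` and the
elastic energy. -/
lemma specTail_le (h : SpectralBounds p G C₀ C₁ C₂) {Λ Λ' : ℝ} (hΛ' : 0 < Λ') (hΛ : Λ' ≤ Λ) :
    specTail p Λ' ≤ (144 * C₀ + 144 * (2 * Real.pi) ^ 4 * C₀ * C₁ + C₂) *
      (specTail p Λ + (Λ / Λ') ^ 4 * ∑' k, G k) := by
  set H := 2 / Λ' with hHdef
  have hH : 0 < H := by positivity
  have hΛ0 : 0 < Λ := hΛ'.trans_le hΛ
  set B := 3 * C₀ * (16 * specTail p Λ + (2 * Real.pi) ^ 4 * C₁ * (H * Λ) ^ 4 * ∑' k, G k) with hB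
  set A : Fin 3 → Fin 3 → (Fin 3 → ℤ) → ℝ := fun i j =>
    {k : Fin 3 → ℤ | 1 ≤ H * |(k i : ℝ)| ∧ 1 ≤ H * |(k j : ℝ)|}.indicator (fun k => ∑ m, p m k)
    with hA
  have hA0 : ∀ i j k, 0 ≤ A i j k := fun i j =>
    Set.indicator_nonneg fun k _ => h.sum_nonneg k
  have hAs : ∀ i j, Summable (A i j) := fun i j => h.summable_sum.indicator _
  have h01 := h.tsum_pair_le 0 1 2 (by decide) (by decide) (by decide) hH hΛ0
  have h12 := h.tsum_pair_le 1 2 0 (by decide) (by decide) (by decide) hH hΛ0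
  have h20 := h.tsum_pair_le 2 0 1 (by decide) (by decide) (by decide) hH hΛ0
  have hpt : ∀ k, {k : Fin 3 → ℤ | ∃ i, Λ' ≤ |(k i : ℝ)|}.indicator (fun k => ∑ m, p m k) k ≤
      A 0 1 k + A 1 2 k + A 2 0 k + C₂ * G k := by
    intro k
    have e := mul_nonneg h.pos₂ (h.energy_nonneg k)
    have a1 := hA0 0 1 k
    have a2 := hA0 1 2 k
    have a3 := hA0 2 0 k
    by_cases hk : ∃ i, Λ' ≤ |(k i : ℝ)|
    · rw [Set.indicator_of_mem (by exact hk)]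
      have hmem : ∀ i j, 1 ≤ H * |(k i : ℝ)| → 1 ≤ H * |(k j : ℝ)| → A i j k = ∑ m, p m k :=
        fun i j h1 h2 => Set.indicator_of_mem (by exact ⟨h1, h2⟩) _
      by_cases c1 : 1 ≤ H * |(k 0 : ℝ)| ∧ 1 ≤ H * |(k 1 : ℝ)|
      · linarith [hmem 0 1 c1.1 c1.2]
      by_cases c2 : 1 ≤ H * |(k 1 : ℝ)| ∧ 1 ≤ H * |(k 2 : ℝ)|
      · linarith [hmem 1 2 c2.1 c2.2]
      by_cases c3 : 1 ≤ H * |(k 2 : ℝ)| ∧ 1 ≤ H * |(k 0 : ℝ)|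
      · linarith [hmem 2 0 c3.1 c3.2]
      obtain ⟨i, hi⟩ := hk
      have hbig : 2 ≤ H * |(k i : ℝ)| := by
        rw [hHdef, div_mul_eq_mul_div, le_div_iff₀ hΛ']
        linarith
      have hsmall : ∀ j, ¬ 1 ≤ H * |(k j : ℝ)| → 2 * |(k j : ℝ)| ≤ |(k i : ℝ)| := by
        intro j hj
        refine le_of_mul_le_mul_left ?_ hH
        linarith
      have hki : k i ≠ 0 := by
        rintro h0
        rw [h0] at hbig
        norm_num at hbig
      have hi1 : 1 ≤ H * |(k i : ℝ)| := by linarith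
      have key : ∑ m, p m k ≤ C₂ * G k := by
        fin_cases i
        · exact h.axial 0 1 2 (by decide) (by decide) (by decide) k hki
            (hsmall 1 fun hh => c1 ⟨hi1, hh⟩) (hsmall 2 fun hh => c3 ⟨hh, hi1⟩)
        · exact h.axial 1 2 0 (by decide) (by decide) (by decide) k hki
            (hsmall 2 fun hh => c2 ⟨hi1, hh⟩) (hsmall 0 fun hh => c1 ⟨hh, hi1⟩)
        · exact h.axial 2 0 1 (by decide) (by decide) (by decide) k hki
            (hsmall 0 fun hh => c3 ⟨hi1, hh⟩) (hsmall 1 fun hh => c2 ⟨hh, hi1⟩)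
      linarith
    · rw [Set.indicator_of_notMem (by exact hk)]
      linarith
  have hsumm := (((hAs 0 1).add (hAs 1 2)).add (hAs 2 0)).add (h.energy_summable.mul_left C₂)
  have hle : specTail p Λ' ≤ 3 * B + C₂ * ∑' k, G k := by
    refine (Summable.tsum_le_tsum hpt (h.summable_sum.indicator _) hsumm).trans ?_
    rw [Summable.tsum_add (((hAs 0 1).add (hAs 1 2)).add (hAs 2 0))
      (h.energy_summable.mul_left C₂), Summable.tsum_add ((hAs 0 1).add (hAs 1 2)) (hAs 2 0),
      Summable.tsum_add (hAs 0 1) (hAs 1 2), tsum_mul_left]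
    linarith
  refine hle.trans ?_
  have hE : 0 ≤ ∑' k, G k := tsum_nonneg h.energy_nonneg
  have hT : 0 ≤ specTail p Λ := tsum_nonneg (Set.indicator_nonneg fun k _ => h.sum_nonneg k)
  have hr : 1 ≤ (Λ / Λ') ^ 4 := one_le_pow₀ ((one_le_div hΛ').2 hΛ)
  have hHL : (H * Λ) ^ 4 = 16 * (Λ / Λ') ^ 4 := by rw [hHdef]; ring
  have hc0 := h.pos₀
  have hc1 := h.pos₁
  have hc2 := h.pos₂
  set r := (Λ / Λ') ^ 4
  have n1 : 0 ≤ 144 * C₀ * (r * ∑' k, G k) := by positivity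
  have n2 : 0 ≤ 144 * (2 * Real.pi) ^ 4 * C₀ * C₁ * specTail p Λ := by positivity
  have n3 : 0 ≤ C₂ * specTail p Λ := by positivity
  have n4 : C₂ * ∑' k, G k ≤ C₂ * (r * ∑' k, G k) :=
    mul_le_mul_of_nonneg_left (le_mul_of_one_le_left hE hr) hc2
  rw [hB, hHL]
  calc _ = 144 * C₀ * specTail p Λ +
        144 * (2 * Real.pi) ^ 4 * C₀ * C₁ * (r * ∑' k, G k) + C₂ * ∑' k, G k := by ring
    _ ≤ _ := by linarith

end SpectralBounds

/-- The Fourier symbol of the elastic energy controls each phase away from two coordinate planes. -/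
lemma cone_estimate {κ : Fin 3 → ℝ} {w X : Fin 3 → ℂ} {F : Fin 3 → Fin 3 → ℂ}
    (hF : ∀ i j, F i j = κ j * w i + κ i * w j - if i = j then X i else 0)
    {i j l : Fin 3} (hij : i ≠ j) (hjl : j ≠ l) (hil : i ≠ l) {N : ℝ} (hN : ∀ a, |κ a| ≤ N) :
    (κ i * κ j) ^ 2 * ‖X l‖ ^ 2 ≤ 16 * N ^ 4 * ∑ i, ∑ j, ‖F i j‖ ^ 2 := by
  set g := ∑ i, ∑ j, ‖F i j‖ ^ 2 with hg
  have hg0 : 0 ≤ g := Finset.sum_nonneg fun i _ => Finset.sum_nonneg fun j _ => sq_nonneg _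
  have hFg : ∀ a b, ‖F a b‖ ≤ √g := fun a b => by
    refine Real.le_sqrt_of_sq_le ?_
    refine (Finset.single_le_sum (f := fun b => ‖F a b‖ ^ 2) (fun b _ => sq_nonneg _)
      (Finset.mem_univ b)).trans ?_
    exact Finset.single_le_sum (f := fun a => ∑ b, ‖F a b‖ ^ 2)
      (fun a _ => Finset.sum_nonneg fun b _ => sq_nonneg _) (Finset.mem_univ a)
  have hN0 : 0 ≤ N := (abs_nonneg _).trans (hN 0)
  have hterm : ∀ a b c d, ‖(κ a : ℂ) * κ b * F c d‖ ≤ N * N * √g := fun a b c d => by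
    rw [norm_mul, norm_mul, Complex.norm_real, Complex.norm_real]
    exact mul_le_mul (mul_le_mul (hN a) (hN b) (abs_nonneg _) hN0) (hFg c d) (norm_nonneg _)
      (mul_nonneg hN0 hN0)
  have hid : (κ i : ℂ) * κ j * X l = κ i * κ l * F j l + κ j * κ l * F i l - κ l * κ l * F i j
      - κ i * κ j * F l l := by
    rw [hF, hF, hF, hF, if_neg hij, if_neg hjl, if_neg hil, if_pos rfl]
    ring
  have hnorm : ‖(κ i : ℂ) * κ j * X l‖ ≤ 4 * (N * N * √g) := by
    rw [hid]
    refine (norm_sub_le _ _).trans ?_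
    have h1 := norm_sub_le ((κ i : ℂ) * κ l * F j l + κ j * κ l * F i l) (κ l * κ l * F i j)
    have h2 := norm_add_le ((κ i : ℂ) * κ l * F j l) (κ j * κ l * F i l)
    linarith [hterm i l j l, hterm j l i l, hterm l l i j, hterm i j l l]
  calc (κ i * κ j) ^ 2 * ‖X l‖ ^ 2 = ‖(κ i : ℂ) * κ j * X l‖ ^ 2 := by
        rw [norm_mul, norm_mul, Complex.norm_real, Complex.norm_real, Real.norm_eq_abs,
          Real.norm_eq_abs, mul_pow, mul_pow, mul_pow, sq_abs, sq_abs]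
    _ ≤ (4 * (N * N * √g)) ^ 2 := by gcongr
    _ = 16 * N ^ 4 * √g ^ 2 := by ring
    _ = _ := by rw [Real.sq_sqrt hg0]

/-- Near a coordinate axis the elastic energy controls all phases. -/
lemma axial_estimate {κ : Fin 3 → ℝ} {w X : Fin 3 → ℂ} {F : Fin 3 → Fin 3 → ℂ}
    (hF : ∀ i j, F i j = κ j * w i + κ i * w j - if i = j then X i else 0)
    {i j l : Fin 3} (hij : i ≠ j) (hil : i ≠ l) (hX : X i + X j + X l = 0) (hi : κ i ≠ 0)
    (hj : 2 * |κ j| ≤ |κ i|) (hl : 2 * |κ l| ≤ |κ i|) :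
    ‖X i‖ ^ 2 + ‖X j‖ ^ 2 + ‖X l‖ ^ 2 ≤ 243 * ∑ i, ∑ j, ‖F i j‖ ^ 2 := by
  set g := ∑ i, ∑ j, ‖F i j‖ ^ 2 with hg
  have hg0 : 0 ≤ g := Finset.sum_nonneg fun i _ => Finset.sum_nonneg fun j _ => sq_nonneg _
  have hFg : ∀ a b, ‖F a b‖ ≤ √g := fun a b => by
    refine Real.le_sqrt_of_sq_le ?_
    refine (Finset.single_le_sum (f := fun b => ‖F a b‖ ^ 2) (fun b _ => sq_nonneg _)
      (Finset.mem_univ b)).trans ?_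
    exact Finset.single_le_sum (f := fun a => ∑ b, ‖F a b‖ ^ 2)
      (fun a _ => Finset.sum_nonneg fun b _ => sq_nonneg _) (Finset.mem_univ a)
  have hiC : (κ i : ℂ) ≠ 0 := by exact_mod_cast hi
  have hi0 : 0 < |κ i| := abs_pos.2 hi
  have hs0 := Real.sqrt_nonneg g
  have hrem : ∀ a, i ≠ a → 2 * |κ a| ≤ |κ i| →
      ∃ (θ : ℝ) (r : ℂ), 0 ≤ θ ∧ θ ≤ 1 / 4 ∧ ‖r‖ ≤ 9 / 4 * √g ∧ X a = -(θ * X i) + r := by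
    intro a ha h2
    have hq : |κ a / κ i| ≤ 1 / 2 := by
      rw [abs_div, div_le_iff₀ hi0]
      linarith
    have hq2 : (κ a / κ i) ^ 2 ≤ 1 / 4 := by
      rw [← sq_abs]
      nlinarith [abs_nonneg (κ a / κ i)]
    refine ⟨(κ a / κ i) ^ 2, 2 * ((κ a / κ i : ℝ) : ℂ) * F i a - F a a -
      (((κ a / κ i) ^ 2 : ℝ) : ℂ) * F i i, sq_nonneg _, hq2, ?_, ?_⟩
    · have n1 : ‖2 * ((κ a / κ i : ℝ) : ℂ) * F i a‖ ≤ √g := by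
        rw [norm_mul, norm_mul, Complex.norm_real, Real.norm_eq_abs, Complex.norm_ofNat]
        have := hFg i a
        nlinarith [abs_nonneg (κ a / κ i), norm_nonneg (F i a)]
      have n2 : ‖(((κ a / κ i) ^ 2 : ℝ) : ℂ) * F i i‖ ≤ 1 / 4 * √g := by
        rw [norm_mul, Complex.norm_real, Real.norm_of_nonneg (sq_nonneg _)]
        exact mul_le_mul hq2 (hFg i i) (norm_nonneg _) (by norm_num)
      have n3 := norm_sub_le (2 * ((κ a / κ i : ℝ) : ℂ) * F i a - F a a)
        ((((κ a / κ i) ^ 2 : ℝ) : ℂ) * F i i)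
      have n4 := norm_sub_le (2 * ((κ a / κ i : ℝ) : ℂ) * F i a) (F a a)
      linarith [hFg a a]
    · rw [hF, hF, hF, if_neg ha, if_pos rfl, if_pos rfl]
      push_cast
      field_simp
      ring
  obtain ⟨α, r, hα0, hα, hr, hXj⟩ := hrem j hij hj
  obtain ⟨β, s, hβ0, hβ, hs, hXl⟩ := hrem l hil hl
  have hsum : ((1 - α - β : ℝ) : ℂ) * X i = -(r + s) := by
    rw [hXj, hXl] at hX
    push_cast
    linear_combination hX
  have hni : ‖X i‖ ≤ 9 * √g := by
    have h1 := congrArg norm hsum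
    rw [norm_mul, Complex.norm_real, Real.norm_of_nonneg (by linarith), norm_neg] at h1
    have h2 := norm_add_le r s
    nlinarith [norm_nonneg (X i)]
  have hother : ∀ (θ : ℝ) (r : ℂ) (a : Fin 3), 0 ≤ θ → θ ≤ 1 / 4 → ‖r‖ ≤ 9 / 4 * √g →
      X a = -(θ * X i) + r → ‖X a‖ ≤ 9 * √g := by
    intro θ r a h0 h1 h2 h3
    rw [h3]
    have h4 := norm_add_le (-((θ : ℂ) * X i)) r
    rw [norm_neg, norm_mul, Complex.norm_real, Real.norm_of_nonneg h0] at h4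
    nlinarith [norm_nonneg (X i)]
  have hsq : ∀ a, ‖X a‖ ≤ 9 * √g → ‖X a‖ ^ 2 ≤ 81 * g := fun a ha => by
    calc ‖X a‖ ^ 2 ≤ (9 * √g) ^ 2 := by gcongr
      _ = 81 * √g ^ 2 := by ring
      _ = _ := by rw [Real.sq_sqrt hg0]
  linarith [hsq i hni, hsq j (hother α r j hα0 hα hr hXj), hsq l (hother β s l hβ0 hβ hs hXl)]

section Wells

variable {η₁ η₂ η₃ : ℝ}

lemma well3_offDiag (a : Fin 3) {i j : Fin 3} (h : i ≠ j) : well3 η₁ η₂ η₃ a i j = 0 := by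
  fin_cases a <;> exact Matrix.diagonal_apply_ne _ h

lemma well3_trace (a : Fin 3) :
    well3 η₁ η₂ η₃ a 0 0 + well3 η₁ η₂ η₃ a 1 1 + well3 η₁ η₂ η₃ a 2 2 = η₁ + η₂ + η₃ := by
  fin_cases a <;> simp [well3] <;> ring

/-- Sums of two entries in a fixed diagonal slot determine the unordered pair of wells. -/
lemma well3_pair_eq (h1 : η₂ < η₁) (h3 : 2 * η₁ < η₂ + η₃) (l a b c d : Fin 3)
    (h : well3 η₁ η₂ η₃ a l l - well3 η₁ η₂ η₃ b l l -
      (well3 η₁ η₂ η₃ c l l - well3 η₁ η₂ η₃ d l l) = 0) :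
    (a = b ∧ c = d) ∨ (a = c ∧ b = d) := by
  fin_cases l <;> fin_cases a <;> fin_cases b <;> fin_cases c <;> fin_cases d <;>
    first
    | simp; done
    | (exfalso; simp [well3] at h; linarith)

lemma exists_well3_transfer (h1 : η₂ < η₁) (h3 : 2 * η₁ < η₂ + η₃) :
    ∃ C₀ : ℝ, 0 ≤ C₀ ∧ ∀ l m a b c d : Fin 3,
      (well3 η₁ η₂ η₃ a m m - well3 η₁ η₂ η₃ b m m -
        (well3 η₁ η₂ η₃ c m m - well3 η₁ η₂ η₃ d m m)) ^ 2 ≤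
      C₀ * (well3 η₁ η₂ η₃ a l l - well3 η₁ η₂ η₃ b l l -
        (well3 η₁ η₂ η₃ c l l - well3 η₁ η₂ η₃ d l l)) ^ 2 := by
  set D : Fin 3 → Fin 3 × Fin 3 × Fin 3 × Fin 3 → ℝ := fun l q =>
    (well3 η₁ η₂ η₃ q.1 l l - well3 η₁ η₂ η₃ q.2.1 l l -
      (well3 η₁ η₂ η₃ q.2.2.1 l l - well3 η₁ η₂ η₃ q.2.2.2 l l)) ^ 2 with hD
  have hD0 : ∀ l q, 0 ≤ D l q := fun l q => sq_nonneg _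
  set R : Fin 3 × Fin 3 × (Fin 3 × Fin 3 × Fin 3 × Fin 3) → ℝ := fun z =>
    D z.2.1 z.2.2 / D z.1 z.2.2 with hR
  have hR0 : ∀ z, 0 ≤ R z := fun z => div_nonneg (hD0 _ _) (hD0 _ _)
  refine ⟨∑ z, R z, Finset.sum_nonneg fun z _ => hR0 z, fun l m a b c d => ?_⟩
  change D m (a, b, c, d) ≤ _ * D l (a, b, c, d)
  by_cases h0 : D l (a, b, c, d) = 0
  · rcases well3_pair_eq h1 h3 l a b c d (pow_eq_zero_iff two_ne_zero |>.1 h0) with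
      ⟨rfl, rfl⟩ | ⟨rfl, rfl⟩ <;> simp [hD]
  · have h4 := Finset.single_le_sum (fun z _ => hR0 z) (Finset.mem_univ (l, m, (a, b, c, d)))
    refine le_trans ?_ (mul_le_mul_of_nonneg_right h4 (hD0 _ _))
    rw [hR]
    simp only
    rw [div_mul_cancel₀ _ h0]

lemma diag_of_mem_Eset3 {e : Matrix (Fin 3) (Fin 3) ℝ} (he : e ∈ Eset3 η₁ η₂ η₃) {i j : Fin 3}
    (hij : i ≠ j) : e i j = 0 := by
  have hlin : IsLinearMap ℝ fun e : Matrix (Fin 3) (Fin 3) ℝ => e i j :=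
    ⟨fun _ _ => rfl, fun _ _ => rfl⟩
  have hconv : Convex ℝ {e : Matrix (Fin 3) (Fin 3) ℝ | e i j = 0} :=
    convex_hyperplane hlin 0
  have hJ : ∀ a, Jmat3 η₁ η₂ η₃ a ∈ {e : Matrix (Fin 3) (Fin 3) ℝ | e i j = 0} := fun a => by
    fin_cases a <;> exact Matrix.diagonal_apply_ne _ hij
  rcases he with he | he
  · refine convexHull_min ?_ hconv he
    rintro _ (rfl | rfl | rfl) <;> exact hJ _
  · obtain ⟨a, ha⟩ := Set.mem_iUnion.1 he
    exact hconv.segment_subset (hJ a) (well3_offDiag a hij) ha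

lemma mem_K3_iff {e : Matrix (Fin 3) (Fin 3) ℝ} :
    e ∈ K3 η₁ η₂ η₃ ↔ ∃ a, e = well3 η₁ η₂ η₃ a := by
  simp [K3, Fin.exists_fin_succ]

/-- A diagonal matrix outside `K₃` has positive distance to every well. -/
lemma exists_dist_K3 {e : Matrix (Fin 3) (Fin 3) ℝ} (he : e ∈ Eset3 η₁ η₂ η₃)
    (hne : e ∉ K3 η₁ η₂ η₃) :
    ∃ d : ℝ, 0 < d ∧ ∀ a, d ≤ ∑ i, (well3 η₁ η₂ η₃ a i i - e i i) ^ 2 := by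
  have hpos : ∀ a, 0 < ∑ i, (well3 η₁ η₂ η₃ a i i - e i i) ^ 2 := fun a => by
    refine lt_of_le_of_ne (Finset.sum_nonneg fun i _ => sq_nonneg _) fun h0 => hne ?_
    rw [eq_comm, Finset.sum_eq_zero_iff_of_nonneg fun i _ => sq_nonneg _] at h0
    refine mem_K3_iff.2 ⟨a, ?_⟩
    ext i j
    by_cases hij : i = j
    · subst hij
      have := pow_eq_zero_iff two_ne_zero |>.1 (h0 i (Finset.mem_univ i))
      linarith
    · rw [diag_of_mem_Eset3 he hij, well3_offDiag a hij]
  obtain ⟨a, ha⟩ := Finite.exists_min fun a => ∑ i, (well3 η₁ η₂ η₃ a i i - e i i) ^ 2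
  exact ⟨_, hpos a, ha⟩

end Wells

/-- Iterating a one-scale estimate over `√|log ε|` scales gives a subexponential lower bound. -/
lemma subexp_lower_bound {Q D d : ℝ} (hQ : 1 ≤ Q) (hD : 1 ≤ D) (hd : 0 < d) {ν : ℝ} (hν : 0 < ν)
    {ε : ℝ} (hε : 0 < ε) (hε1 : ε < Real.exp (-1)) {T : ℝ → ℝ} {E : ℝ}
    (hanti : ∀ a b, a ≤ b → T b ≤ T a) (hstart : T ε⁻¹ ≤ D * E) (hE : 0 ≤ E)
    (hrec : ∀ a b, 0 < a → a ≤ b → T a ≤ Q * (T b + (b / a) ^ 4 * E)) (hend : d ≤ T 1 + E) :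
    d / (2 * Q * D + 1) *
      Real.exp (-((Real.log (2 * Q) + 4) * |Real.log ε| ^ ((1 : ℝ) / 2 + ν))) ≤ E := by
  have hlog : Real.log ε < -1 := by
    rw [Real.log_lt_iff_lt_exp hε]
    exact hε1
  set L := |Real.log ε| with hL
  have hL1 : 1 ≤ L := by
    rw [hL, abs_of_neg (by linarith)]
    linarith
  have hexpL : Real.exp L = ε⁻¹ := by
    rw [hL, abs_of_neg (by linarith), Real.exp_neg, Real.exp_log hε]
  set M := Real.exp (√L) with hM
  have hM0 : 0 < M := Real.exp_pos _
  have hM1 : 1 ≤ M := Real.one_le_exp (Real.sqrt_nonneg _)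
  have hM4 : 1 ≤ M ^ 4 := one_le_pow₀ hM1
  have h2Q : 1 ≤ 2 * Q := by linarith
  have hiter : ∀ m : ℕ, T (ε⁻¹ / M ^ m) ≤ (2 * Q) ^ m * D * M ^ 4 * E := by
    intro m
    induction m with
    | zero =>
      simp only [pow_zero, div_one, one_mul]
      refine hstart.trans (mul_le_mul_of_nonneg_right ?_ hE)
      exact le_mul_of_one_le_right (by linarith) hM4
    | succ m ih =>
      have hpos : 0 < ε⁻¹ / M ^ (m + 1) := by positivity
      have hratio : ε⁻¹ / M ^ m / (ε⁻¹ / M ^ (m + 1)) = M := by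
        field_simp
        ring
      have hle : ε⁻¹ / M ^ (m + 1) ≤ ε⁻¹ / M ^ m := by
        refine div_le_div_of_nonneg_left (by positivity) (by positivity) ?_
        exact pow_le_pow_right₀ hM1 (Nat.le_succ m)
      refine (hrec _ _ hpos hle).trans ?_
      rw [hratio]
      have h1 : 1 ≤ (2 * Q) ^ m * D := one_le_mul_of_one_le_of_one_le (one_le_pow₀ h2Q) hD
      have h2 : M ^ 4 * E ≤ (2 * Q) ^ m * D * M ^ 4 * E := by
        rw [mul_assoc _ (M ^ 4)]
        exact le_mul_of_one_le_left (by positivity) h1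
      calc _ ≤ Q * ((2 * Q) ^ m * D * M ^ 4 * E + (2 * Q) ^ m * D * M ^ 4 * E) := by gcongr
        _ = _ := by ring
  set m := ⌈√L⌉₊ with hm
  have hm1 : √L ≤ m := Nat.le_ceil _
  have hm2 : (m : ℝ) ≤ √L + 1 := (Nat.ceil_lt_add_one (Real.sqrt_nonneg _)).le
  have hsmall : ε⁻¹ / M ^ m ≤ 1 := by
    rw [div_le_one (by positivity), ← hexpL, hM, ← Real.exp_nat_mul]
    refine Real.exp_le_exp.2 ?_
    calc L = √L * √L := (Real.mul_self_sqrt (by linarith)).symm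
      _ ≤ m * √L := by gcongr
  have hpow : (2 * Q) ^ m ≤ 2 * Q * Real.exp (Real.log (2 * Q) * √L) := by
    have h0 : 0 < 2 * Q := by linarith
    have hl : 0 ≤ Real.log (2 * Q) := Real.log_nonneg h2Q
    calc (2 * Q) ^ m = Real.exp (m * Real.log (2 * Q)) := by
          rw [Real.exp_nat_mul, Real.exp_log h0]
      _ ≤ Real.exp (Real.log (2 * Q) + Real.log (2 * Q) * √L) := by
          refine Real.exp_le_exp.2 ?_
          nlinarith
      _ = _ := by rw [Real.exp_add, Real.exp_log h0]
  set c := Real.log (2 * Q) + 4 with hc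
  have hc0 : 0 < c := by
    have := Real.log_nonneg h2Q
    linarith
  have hT1 : T 1 ≤ 2 * Q * D * Real.exp (c * √L) * E := by
    refine (hanti _ _ hsmall).trans ((hiter m).trans ?_)
    have h4 : M ^ 4 = Real.exp (4 * √L) := by
      rw [hM, ← Real.exp_nat_mul]
      norm_num
    calc (2 * Q) ^ m * D * M ^ 4 * E
        ≤ 2 * Q * Real.exp (Real.log (2 * Q) * √L) * D * M ^ 4 * E := by gcongr
      _ = 2 * Q * D * (Real.exp (Real.log (2 * Q) * √L) * Real.exp (4 * √L)) * E := by
          rw [h4]; ring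
      _ = _ := by rw [← Real.exp_add, hc, add_mul]
  have hsL : √L ≤ L ^ ((1 : ℝ) / 2 + ν) := by
    rw [Real.sqrt_eq_rpow]
    exact Real.rpow_le_rpow_of_exponent_le hL1 (by linarith)
  have hexp1 : 1 ≤ Real.exp (c * √L) := Real.one_le_exp (by positivity)
  have hdE : d ≤ (2 * Q * D + 1) * Real.exp (c * √L) * E := by
    have : E ≤ Real.exp (c * √L) * E := le_mul_of_one_le_left hE hexp1
    linarith
  have hden : 0 < 2 * Q * D + 1 := by positivity
  have hmono : Real.exp (-(c * L ^ ((1 : ℝ) / 2 + ν))) ≤ Real.exp (-(c * √L)) := by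
    refine Real.exp_le_exp.2 (neg_le_neg ?_)
    gcongr
  calc d / (2 * Q * D + 1) * Real.exp (-(c * L ^ ((1 : ℝ) / 2 + ν)))
      ≤ d / (2 * Q * D + 1) * Real.exp (-(c * √L)) := by gcongr
    _ ≤ E := by
      rw [Real.exp_neg, ← div_eq_mul_inv, div_div, div_le_iff₀ (by positivity)]
      linarith

section Energy

variable {η₁ η₂ η₃ : ℝ} {ebar : Matrix (Fin 3) (Fin 3) ℝ} {v : V3 → V3} {K : NNReal}
  {χ : V3 → Matrix (Fin 3) (Fin 3) ℝ}

/-- The strain error `e(u) - χ` of `u = ēx + v`. -/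
def strainError (ebar : Matrix (Fin 3) (Fin 3) ℝ) (v : V3 → V3)
    (χ : V3 → Matrix (Fin 3) (Fin 3) ℝ) (i j : Fin 3) (x : V3) : ℝ :=
  ebar i j + 1 / 2 * (pderiv3 v i j x + pderiv3 v j i x) - χ x i j

/-- The elastic energy density in Fourier space. -/
def energySpec (ebar : Matrix (Fin 3) (Fin 3) ℝ) (v : V3 → V3)
    (χ : V3 → Matrix (Fin 3) (Fin 3) ℝ) (k : Fin 3 → ℤ) : ℝ :=
  ∑ i, ∑ j, ‖fc (strainError ebar v χ i j) k‖ ^ 2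

/-- The Fourier spectrum of the `m`-th diagonal entry of the phase field. -/
def phaseSpec (χ : V3 → Matrix (Fin 3) (Fin 3) ℝ) (m : Fin 3) (k : Fin 3 → ℤ) : ℝ :=
  ‖fc (fun x => χ x m m) k‖ ^ 2

lemma symGrad3_add_ae (hv : LipschitzWith K v) (hsymm : ∀ i j, ebar i j = ebar j i)
    {s : Matrix (Fin 3) (Fin 3) ℝ} (hs : sᵀ = -s) :
    ∀ᵐ x, ∀ i j, symGrad3 (fun x => vec3 ((ebar + s).mulVec fun i => x i) + v x) x i j =
      ebar i j + 1 / 2 * (pderiv3 v i j x + pderiv3 v j i x) := by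
  filter_upwards [hv.ae_differentiableAt] with x hx i j
  have hlin : HasFDerivAt (fun x : V3 => vec3 ((ebar + s).mulVec fun i => x i))
      (LinearMap.toContinuousLinearMap (Matrix.toLpLin 2 2 (ebar + s))) x :=
    (LinearMap.toContinuousLinearMap (Matrix.toLpLin 2 2 (ebar + s))).hasFDerivAt
  have hcoord : ∀ a b, LinearMap.toContinuousLinearMap (Matrix.toLpLin 2 2 (ebar + s))
      (EuclideanSpace.single b 1 : V3) a = ebar a b + s a b := fun a b => by
    simp [Matrix.toLpLin_apply]
  have hsij : s j i = -s i j := congrFun (congrFun hs i) j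
  have hadd : HasFDerivAt (fun x : V3 => vec3 ((ebar + s).mulVec fun i => x i) + v x)
      (LinearMap.toContinuousLinearMap (Matrix.toLpLin 2 2 (ebar + s)) + fderiv ℝ v x) x :=
    hlin.add hx.hasFDerivAt
  rw [symGrad3, hadd.fderiv]
  simp only [_root_.add_apply, PiLp.add_apply, hcoord, hsymm j i, hsij, pderiv3]
  ring

lemma fc_pderiv3_zero (hv : LipschitzWith K v) (hp : ZPer v) (i j : Fin 3) :
    ∫ x in cube3, pderiv3 v i j x = 0 := by
  have h := fc_pderiv3 hv hp i j 0
  rw [fc_zero] at h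
  simpa using h

lemma bddMeas_phase (hχm : ∀ i j : Fin 3, Measurable fun x => χ x i j)
    (hχK : ∀ x, χ x ∈ K3 η₁ η₂ η₃) (i j : Fin 3) : BddMeas fun x => χ x i j := by
  refine ⟨hχm i j, ∑ a, |well3 η₁ η₂ η₃ a i j|, fun x => ?_⟩
  obtain ⟨a, ha⟩ := mem_K3_iff.1 (hχK x)
  simp only [ha]
  exact Finset.single_le_sum (f := fun a => |well3 η₁ η₂ η₃ a i j|) (fun a _ => abs_nonneg _)
    (Finset.mem_univ a)

lemma zper_phase (hχp : ZPer χ) (i j : Fin 3) : ZPer fun x => χ x i j := fun x n => by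
  simp only [hχp x n]

lemma bddMeas_strainError (hv : LipschitzWith K v)
    (hb : ∀ i j : Fin 3, BddMeas fun x => χ x i j) (i j : Fin 3) :
    BddMeas (strainError ebar v χ i j) :=
  ((BddMeas.const _).add (((BddMeas.pderiv3 hv i j).add (BddMeas.pderiv3 hv j i)).const_mul _)).sub
    (hb i j)

lemma fc_strainError (hv : LipschitzWith K v) (hvp : ZPer v)
    (hb : ∀ i j : Fin 3, BddMeas fun x => χ x i j) (hoff : ∀ x i j, i ≠ j → χ x i j = 0)
    {k : Fin 3 → ℤ} (hk : k ≠ 0) (i j : Fin 3) :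
    fc (strainError ebar v χ i j) k =
      ((k j : ℝ) : ℂ) * (Real.pi * Complex.I * fc (fun x => v x i) k) +
      ((k i : ℝ) : ℂ) * (Real.pi * Complex.I * fc (fun x => v x j) k) -
      if i = j then fc (fun x => χ x i i) k else 0 := by
  have hd := (BddMeas.pderiv3 hv i j).add (BddMeas.pderiv3 hv j i)
  have h0 : fc (fun x => χ x i j) k = if i = j then fc (fun x => χ x i i) k else 0 := by
    split_ifs with h
    · rw [h]
    · simp only [hoff _ _ _ h, fc_const hk]
  unfold strainError
  rw [fc_sub ((BddMeas.const _).add (hd.const_mul _)) (hb i j),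
    fc_add (BddMeas.const _) (hd.const_mul _), fc_const hk, fc_const_mul,
    fc_add (BddMeas.pderiv3 hv i j) (BddMeas.pderiv3 hv j i), fc_pderiv3 hv hvp,
    fc_pderiv3 hv hvp, h0]
  push_cast
  ring

lemma hasSum_energySpec (hv : LipschitzWith K v)
    (hb : ∀ i j : Fin 3, BddMeas fun x => χ x i j) :
    HasSum (energySpec ebar v χ) (∫ x in cube3, ∑ i, ∑ j, strainError ebar v χ i j x ^ 2) := by
  have hi : ∀ i j, Integrable (fun x => strainError ebar v χ i j x ^ 2) (volume.restrict cube3) :=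
    fun i j => (bddMeas_strainError hv hb i j).sq.integrable
  rw [integral_finsetSum _ fun i _ => integrable_finsetSum _ fun j _ => hi i j]
  simp only [integral_finsetSum Finset.univ fun j _ => hi _ j]
  exact hasSum_sum fun i _ => hasSum_sum fun j _ => (bddMeas_strainError hv hb i j).hasSum_fc

lemma energySpec_nonneg (k : Fin 3 → ℤ) : 0 ≤ energySpec ebar v χ k :=
  Finset.sum_nonneg fun _ _ => Finset.sum_nonneg fun _ _ => sq_nonneg _

lemma hasSum_phaseSpec_diff (hb : ∀ i j : Fin 3, BddMeas fun x => χ x i j) (hp : ZPer χ)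
    (i j m : Fin 3) (t s : ℝ) :
    HasSum (fun k => diffSq t (k i) * (diffSq s (k j) * phaseSpec χ m k))
      (∫ x in cube3, diff i t (diff j s fun x => χ x m m) x ^ 2) := by
  have h := (((hb m m).diff j s).diff i t).hasSum_fc
  refine h.congr_fun fun k => ?_
  rw [norm_fc_diff_sq ((hb m m).diff j s) ((zper_phase hp m m).diff j s),
    norm_fc_diff_sq (hb m m) (zper_phase hp m m), phaseSpec]

lemma spectralBounds_phase (hv : LipschitzWith K v) (hvp : ZPer v)
    (hχm : ∀ i j : Fin 3, Measurable fun x => χ x i j) (hχp : ZPer χ)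
    (hχK : ∀ x, χ x ∈ K3 η₁ η₂ η₃) {C₀ : ℝ} (hC₀ : 0 ≤ C₀)
    (htr : ∀ l m a b c d : Fin 3,
      (well3 η₁ η₂ η₃ a m m - well3 η₁ η₂ η₃ b m m -
        (well3 η₁ η₂ η₃ c m m - well3 η₁ η₂ η₃ d m m)) ^ 2 ≤
      C₀ * (well3 η₁ η₂ η₃ a l l - well3 η₁ η₂ η₃ b l l -
        (well3 η₁ η₂ η₃ c l l - well3 η₁ η₂ η₃ d l l)) ^ 2) :
    SpectralBounds (phaseSpec χ) (energySpec ebar v χ) C₀ 16 243 := by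
  have hb := bddMeas_phase hχm hχK
  have hoff : ∀ x i j, i ≠ j → χ x i j = 0 := fun x i j hij => by
    obtain ⟨a, ha⟩ := mem_K3_iff.1 (hχK x)
    rw [ha, well3_offDiag a hij]
  refine ⟨fun m k => sq_nonneg _, fun m => (hb m m).hasSum_fc.summable, energySpec_nonneg,
    (hasSum_energySpec hv hb).summable, hC₀, by norm_num, by norm_num, ?_, ?_, ?_⟩
  · intro i j l m _ _ _ t s
    rw [(hasSum_phaseSpec_diff hb hχp i j m t s).tsum_eq,
      (hasSum_phaseSpec_diff hb hχp i j l t s).tsum_eq, ← integral_const_mul]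
    refine integral_mono (((hb m m).diff j s).diff i t).sq.integrable
      ((((hb l l).diff j s).diff i t).sq.const_mul C₀).integrable fun x => ?_
    obtain ⟨a, ha⟩ := mem_K3_iff.1 (hχK (x + axis i t + axis j s))
    obtain ⟨b, hb⟩ := mem_K3_iff.1 (hχK (x + axis i t))
    obtain ⟨c, hc⟩ := mem_K3_iff.1 (hχK (x + axis j s))
    obtain ⟨d, hd⟩ := mem_K3_iff.1 (hχK x)
    simp only [diff, ha, hb, hc, hd]
    exact htr l m a b c d
  · intro i j l hij hjl hil k N hN
    by_cases hk : k = 0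
    · simp only [hk, Pi.zero_apply, Int.cast_zero, mul_zero, ne_eq, OfNat.ofNat_ne_zero,
        not_false_eq_true, zero_pow, zero_mul]
      exact mul_nonneg (by positivity) (energySpec_nonneg _)
    · exact cone_estimate (κ := fun a => (k a : ℝ)) (X := fun m => fc (fun x => χ x m m) k)
        (fc_strainError hv hvp hb hoff hk) hij hjl hil hN
  · intro i j l hij hjl hil k hki hj hl
    have hk : k ≠ 0 := fun h => hki (by rw [h]; rfl)
    have htrace : ∀ x, χ x 0 0 + χ x 1 1 + χ x 2 2 = η₁ + η₂ + η₃ := fun x => by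
      obtain ⟨a, ha⟩ := mem_K3_iff.1 (hχK x)
      rw [ha, well3_trace a]
    have hX0 : fc (fun x => χ x 0 0) k + fc (fun x => χ x 1 1) k + fc (fun x => χ x 2 2) k = 0 := by
      rw [← fc_add (hb 0 0) (hb 1 1), ← fc_add ((hb 0 0).add (hb 1 1)) (hb 2 2)]
      simp only [htrace, fc_const hk]
    have hperm : ∀ (M : Type) [AddCommMonoid M] (f : Fin 3 → M), f i + f j + f l = f 0 + f 1 + f 2 :=
      fun M _ f => by
        rw [← Fin.sum_univ_three]
        have huniv : (Finset.univ : Finset (Fin 3)) = {i, j, l} := by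
          revert hij hjl hil
          clear * -
          decide +revert
        rw [huniv, Finset.sum_insert (by simp [hij, hil]), Finset.sum_pair hjl, add_assoc]
    rw [Fin.sum_univ_three, ← hperm ℝ fun m => phaseSpec χ m k]
    exact axial_estimate (κ := fun a => (k a : ℝ)) (X := fun m => fc (fun x => χ x m m) k)
      (fc_strainError hv hvp hb hoff hk) hij hil
      ((hperm ℂ fun m => fc (fun x => χ x m m) k).trans hX0) (by exact_mod_cast hki) hj hl

end Energy

section Estimates

variable {η₁ η₂ η₃ : ℝ} {ebar : Matrix (Fin 3) (Fin 3) ℝ} {v : V3 → V3} {K : NNReal}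
  {χ : V3 → Matrix (Fin 3) (Fin 3) ℝ}

lemma well3_injective (h1 : η₂ < η₁) (h3 : 2 * η₁ < η₂ + η₃) :
    Function.Injective (well3 η₁ η₂ η₃) := fun a b hab => by
  rcases well3_pair_eq h1 h3 0 a b 0 0 (by rw [hab]; ring) with h | h
  · exact h.1
  · exact h.1.trans h.2.symm

lemma indic3_mem_Icc (a : Fin 3) (x : V3) :
    0 ≤ indic3 η₁ η₂ η₃ χ a x ∧ indic3 η₁ η₂ η₃ χ a x ≤ 1 :=
  ⟨Set.indicator_nonneg (fun _ _ => zero_le_one) x,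
    Set.indicator_le_self' (fun _ _ => zero_le_one) x⟩

lemma bddMeas_indic3 (hχm : ∀ i j : Fin 3, Measurable fun x => χ x i j) (a : Fin 3) :
    BddMeas (indic3 η₁ η₂ η₃ χ a) := by
  refine ⟨measurable_const.indicator ?_, 1, fun x => ?_⟩
  · have : {x | χ x = well3 η₁ η₂ η₃ a} = ⋂ i, ⋂ j, {x | χ x i j = well3 η₁ η₂ η₃ a i j} := by
      ext x
      simp [← Matrix.ext_iff]
    rw [this]
    exact MeasurableSet.iInter fun i => MeasurableSet.iInter fun j =>
      hχm i j (measurableSet_singleton _)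
  · have := indic3_mem_Icc (η₁ := η₁) (η₂ := η₂) (η₃ := η₃) (χ := χ) a x
    rw [abs_of_nonneg this.1]
    exact this.2

lemma zper_indic3 (hχp : ZPer χ) (a : Fin 3) : ZPer (indic3 η₁ η₂ η₃ χ a) := fun x n => by
  simp only [indic3, Set.indicator, Set.mem_ofPred_eq, hχp x n]

lemma phase_eq_sum_indic3 (hinj : Function.Injective (well3 η₁ η₂ η₃))
    (hχK : ∀ x, χ x ∈ K3 η₁ η₂ η₃) (m : Fin 3) (x : V3) :
    χ x m m = ∑ a, well3 η₁ η₂ η₃ a m m * indic3 η₁ η₂ η₃ χ a x := by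
  obtain ⟨b, hb⟩ := mem_K3_iff.1 (hχK x)
  rw [Finset.sum_eq_single b]
  · rw [indic3, Set.indicator_of_mem (by exact hb), mul_one, hb]
  · intro a _ hab
    rw [indic3, Set.indicator_of_notMem, mul_zero]
    intro h
    exact hab (hinj (h.symm.trans hb))
  · simp

lemma IsTVBound.nonneg {f : V3 → ℝ} {S : ℝ} (h : IsTVBound f S) : 0 ≤ S := by
  have := h (fun _ => 0) contDiff_const (fun _ _ => rfl) (by simp)
  simpa using this

/-- The high frequency part of the phases is controlled by the perimeter. -/
lemma specTail_le_perimeter (hinj : Function.Injective (well3 η₁ η₂ η₃))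
    (hχm : ∀ i j : Fin 3, Measurable fun x => χ x i j) (hχp : ZPer χ)
    (hχK : ∀ x, χ x ∈ K3 η₁ η₂ η₃) {S : Fin 3 → ℝ}
    (hS : ∀ a, IsTVBound (indic3 η₁ η₂ η₃ χ a) (S a)) {Λ : ℝ} (hΛ : 0 < Λ) :
    specTail (phaseSpec χ) Λ ≤
      3 * ((∑ m, ∑ a, well3 η₁ η₂ η₃ a m m ^ 2) * (Λ⁻¹ * ∑ a, S a)) := by
  have hb := bddMeas_phase hχm hχK
  set W := ∑ m, ∑ a, well3 η₁ η₂ η₃ a m m ^ 2 with hW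
  have hW0 : 0 ≤ W := Finset.sum_nonneg fun _ _ => Finset.sum_nonneg fun _ _ => sq_nonneg _
  have hS0 : 0 ≤ ∑ a, S a := Finset.sum_nonneg fun a _ => (hS a).nonneg
  have hp0 : ∀ k, 0 ≤ ∑ m, phaseSpec χ m k := fun k => Finset.sum_nonneg fun m _ => sq_nonneg _
  have hps : Summable fun k => ∑ m, phaseSpec χ m k :=
    summable_sum fun m _ => (hb m m).hasSum_fc.summable
  have hdiff : ∀ i t, 0 ≤ t → t ≤ Λ⁻¹ →
      ∑' k, diffSq t (k i) * ∑ m, phaseSpec χ m k ≤ W * (Λ⁻¹ * ∑ a, S a) := by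
    intro i t ht0 ht1
    have hsum : HasSum (fun k => diffSq t (k i) * ∑ m, phaseSpec χ m k)
        (∑ m, ∫ x in cube3, diff i t (fun x => χ x m m) x ^ 2) := by
      refine (hasSum_sum fun m _ => ((hb m m).diff i t).hasSum_fc).congr_fun fun k => ?_
      rw [Finset.mul_sum]
      exact Finset.sum_congr rfl fun m _ => norm_fc_diff_sq (hb m m) (zper_phase hχp m m) i t k |>.symm
    rw [hsum.tsum_eq, hW, Finset.sum_mul]
    refine Finset.sum_le_sum fun m _ => ?_
    have hw0 : 0 ≤ ∑ a, well3 η₁ η₂ η₃ a m m ^ 2 := Finset.sum_nonneg fun _ _ => sq_nonneg _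
    have h_int : ∀ a, Integrable (fun x => diff i t (indic3 η₁ η₂ η₃ χ a) x ^ 2)
        (volume.restrict cube3) := fun a => ((bddMeas_indic3 hχm a).diff i t).sq.integrable
    calc ∫ x in cube3, diff i t (fun x => χ x m m) x ^ 2
        ≤ ∫ x in cube3, (∑ a, well3 η₁ η₂ η₃ a m m ^ 2) *
            ∑ a, diff i t (indic3 η₁ η₂ η₃ χ a) x ^ 2 := by
          refine integral_mono ((hb m m).diff i t).sq.integrable
            ((integrable_finsetSum _ fun a _ => h_int a).const_mul _) fun x => ?_
          have : diff i t (fun x => χ x m m) x =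
              ∑ a, well3 η₁ η₂ η₃ a m m * diff i t (indic3 η₁ η₂ η₃ χ a) x := by
            simp only [diff, phase_eq_sum_indic3 hinj hχK, mul_sub, Finset.sum_sub_distrib]
          simp only [this]
          exact Finset.sum_mul_sq_le_sq_mul_sq _ _ _
      _ = (∑ a, well3 η₁ η₂ η₃ a m m ^ 2) *
            ∑ a, ∫ x in cube3, diff i t (indic3 η₁ η₂ η₃ χ a) x ^ 2 := by
          rw [integral_const_mul, integral_finsetSum _ fun a _ => h_int a]
      _ ≤ (∑ a, well3 η₁ η₂ η₃ a m m ^ 2) * (Λ⁻¹ * ∑ a, S a) := by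
          refine mul_le_mul_of_nonneg_left ?_ hw0
          rw [Finset.mul_sum]
          refine Finset.sum_le_sum fun a _ => ?_
          exact ((hS a).integral_diff_sq_le (bddMeas_indic3 hχm a) (zper_indic3 hχp a)
            (indic3_mem_Icc a) i ht0).trans (mul_le_mul_of_nonneg_right ht1 (hS a).nonneg)
  have hi := fun i => tsum_indicator_le_of_diffSq hp0 hps i (inv_pos.2 hΛ) (hdiff i)
  have hsi : ∀ i : Fin 3, Summable ({k : Fin 3 → ℤ | 1 ≤ Λ⁻¹ * |(k i : ℝ)|}.indicator
      fun k => ∑ m, phaseSpec χ m k) := fun i => hps.indicator _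
  calc specTail (phaseSpec χ) Λ
      ≤ ∑' k, ∑ i, {k : Fin 3 → ℤ | 1 ≤ Λ⁻¹ * |(k i : ℝ)|}.indicator
          (fun k => ∑ m, phaseSpec χ m k) k := by
        refine Summable.tsum_le_tsum (fun k => ?_) (hps.indicator _)
          (summable_sum fun i _ => hsi i)
        have hn : ∀ i : Fin 3, 0 ≤ {k : Fin 3 → ℤ | 1 ≤ Λ⁻¹ * |(k i : ℝ)|}.indicator
          (fun k => ∑ m, phaseSpec χ m k) k := fun i => Set.indicator_nonneg (fun k _ => hp0 k) k
        by_cases hk : ∃ i, Λ ≤ |(k i : ℝ)|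
        · obtain ⟨i, hik⟩ := hk
          refine le_trans (le_of_eq ?_) (Finset.single_le_sum (fun i _ => hn i) (Finset.mem_univ i))
          have hmem : 1 ≤ Λ⁻¹ * |(k i : ℝ)| := by
            rw [inv_mul_eq_div, one_le_div hΛ]
            exact hik
          rw [Set.indicator_of_mem (by exact ⟨i, hik⟩), Set.indicator_of_mem (by exact hmem)]
        · rw [Set.indicator_of_notMem (by exact hk)]
          exact Finset.sum_nonneg fun i _ => hn i
    _ = ∑ i, ∑' k, {k : Fin 3 → ℤ | 1 ≤ Λ⁻¹ * |(k i : ℝ)|}.indicator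
          (fun k => ∑ m, phaseSpec χ m k) k := Summable.tsum_finsetSum fun i _ => hsi i
    _ ≤ ∑ _i : Fin 3, W * (Λ⁻¹ * ∑ a, S a) := Finset.sum_le_sum fun i _ => hi i
    _ = _ := by simp

/-- The phases oscillate by a definite amount around the mean strain. -/
lemma le_specTail_one_add (hv : LipschitzWith K v) (hvp : ZPer v)
    (hχm : ∀ i j : Fin 3, Measurable fun x => χ x i j) (hχK : ∀ x, χ x ∈ K3 η₁ η₂ η₃) {d : ℝ}
    (hd : ∀ a, d ≤ ∑ i, (well3 η₁ η₂ η₃ a i i - ebar i i) ^ 2) :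
    d ≤ specTail (phaseSpec χ) 1 + ∑' k, energySpec ebar v χ k := by
  have hb := bddMeas_phase hχm hχK
  have hbd : ∀ i, BddMeas fun x => χ x i i - ebar i i := fun i => (hb i i).sub (BddMeas.const _)
  have hp0 : ∀ k, 0 ≤ ∑ m, phaseSpec χ m k := fun k => Finset.sum_nonneg fun m _ => sq_nonneg _
  have hps : Summable fun k => ∑ m, phaseSpec χ m k :=
    summable_sum fun m _ => (hb m m).hasSum_fc.summable
  have hes := (hasSum_energySpec (ebar := ebar) hv hb).summable
  have hlow : d ≤ ∫ x in cube3, ∑ i, (χ x i i - ebar i i) ^ 2 := by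
    calc d = ∫ _x in cube3, d := by simp [volume_real_cube3]
      _ ≤ _ := by
        refine integral_mono (integrable_const _)
          (integrable_finsetSum _ fun i _ => (hbd i).sq.integrable) fun x => ?_
        obtain ⟨a, ha⟩ := mem_K3_iff.1 (hχK x)
        simp only [ha]
        exact hd a
  rw [integral_finsetSum _ fun i _ => (hbd i).sq.integrable] at hlow
  have hsum := hasSum_sum (s := Finset.univ) fun i _ => (hbd i).hasSum_fc
  rw [← hsum.tsum_eq] at hlow
  refine hlow.trans ?_
  rw [specTail, ← (hps.indicator _).tsum_add hes]
  refine Summable.tsum_le_tsum (fun k => ?_) hsum.summable ((hps.indicator _).add hes)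
  by_cases hk : k = 0
  · refine le_trans ?_ (le_add_of_nonneg_left (Set.indicator_nonneg (fun k _ => hp0 k) k))
    refine Finset.sum_le_sum fun i _ => ?_
    refine le_trans (le_of_eq ?_) (Finset.single_le_sum
      (f := fun j => ‖fc (strainError ebar v χ i j) k‖ ^ 2) (fun j _ => sq_nonneg _)
      (Finset.mem_univ i))
    have h1 : ∫ x in cube3, strainError ebar v χ i i x = -∫ x in cube3, (χ x i i - ebar i i) := by
      have hpd := BddMeas.pderiv3 hv i i
      unfold strainError
      rw [integral_sub ((BddMeas.const _).add ((hpd.add hpd).const_mul _)).integrable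
        (hb i i).integrable, integral_add (BddMeas.const _).integrable
        ((hpd.add hpd).const_mul _).integrable, integral_const_mul,
        integral_add hpd.integrable hpd.integrable, fc_pderiv3_zero hv hvp,
        integral_sub (hb i i).integrable (BddMeas.const _).integrable]
      ring
    rw [hk, fc_zero, fc_zero, h1, Complex.ofReal_neg, norm_neg]
  · obtain ⟨a, ha⟩ := Function.ne_iff.1 hk
    have hmem : ∃ i, (1 : ℝ) ≤ |(k i : ℝ)| := ⟨a, by exact_mod_cast Int.one_le_abs ha⟩
    rw [Set.indicator_of_mem (by exact hmem)]
    refine le_trans (le_of_eq (Finset.sum_congr rfl fun i _ => ?_))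
      (le_add_of_nonneg_right (energySpec_nonneg k))
    rw [fc_sub (hb i i) (BddMeas.const _), fc_const hk, sub_zero, phaseSpec]

end Estimates

/-- lower scaling bound for the energy of the T₃-structure on the torus. -/
theorem stmt15 (η₁ η₂ η₃ : ℝ) (h1 : η₂ < η₁) (h2 : η₁ < η₃) (h3 : 2 * η₁ < η₂ + η₃)
    (ebar : Matrix (Fin 3) (Fin 3) ℝ) (hebar : ebar ∈ Eset3 η₁ η₂ η₃)
    (hne : ebar ∉ K3 η₁ η₂ η₃)
    (ν : ℝ) (hν : ν ∈ Set.Ioo (0 : ℝ) 1) :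
    ∃ ε₀ c C₁ : ℝ, 0 < ε₀ ∧ 0 < c ∧ 0 < C₁ ∧
    ∀ ε : ℝ, 0 < ε → ε < ε₀ →
    ∀ u : V3 → V3, Admissible ebar u →
    ∀ χ : V3 → Matrix (Fin 3) (Fin 3) ℝ, (∀ i j : Fin 3, Measurable fun x => χ x i j) →
      ZPer χ → (∀ x, χ x ∈ K3 η₁ η₂ η₃) →
    ∀ S₁ S₂ S₃ : ℝ,
      IsTVBound (indic3 η₁ η₂ η₃ χ 0) S₁ →
      IsTVBound (indic3 η₁ η₂ η₃ χ 1) S₂ →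
      IsTVBound (indic3 η₁ η₂ η₃ χ 2) S₃ →
      (∫ x in cube3, ∑ i : Fin 3, ∑ j : Fin 3, (symGrad3 u x i j - χ x i j) ^ 2) +
          ε * (S₁ + S₂ + S₃) ≥
        C₁ * Real.exp (-(c * |Real.log ε| ^ ((1 : ℝ) / 2 + ν))) := by
  obtain ⟨C₀, hC₀, htr⟩ := exists_well3_transfer h1 h3
  obtain ⟨d, hd0, hd⟩ := exists_dist_K3 hebar hne
  have hinj := well3_injective h1 h3
  have hsymm : ∀ i j, ebar i j = ebar j i := fun i j => by
    by_cases hij : i = j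
    · rw [hij]
    · rw [diag_of_mem_Eset3 hebar hij, diag_of_mem_Eset3 hebar (Ne.symm hij)]
  set W := ∑ m, ∑ a, well3 η₁ η₂ η₃ a m m ^ 2 with hW
  have hW0 : 0 ≤ W := Finset.sum_nonneg fun _ _ => Finset.sum_nonneg fun _ _ => sq_nonneg _
  set Q := 144 * C₀ + 144 * (2 * Real.pi) ^ 4 * C₀ * 16 + 243 with hQ
  have hQ1 : 1 ≤ Q := by
    have : 0 ≤ 144 * C₀ + 144 * (2 * Real.pi) ^ 4 * C₀ * 16 := by positivity
    linarith
  have hD1 : 1 ≤ 3 * W + 1 := by linarith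
  refine ⟨Real.exp (-1), Real.log (2 * Q) + 4, d / (2 * Q * (3 * W + 1) + 1), Real.exp_pos _, ?_,
    by positivity, ?_⟩
  · have := Real.log_nonneg (show 1 ≤ 2 * Q by linarith)
    linarith
  intro ε hε hε0 u hu χ hχm hχp hχK S₁ S₂ S₃ hS₁ hS₂ hS₃
  obtain ⟨s, hs, v, K, hv, hvp, rfl⟩ := hu
  have hb := bddMeas_phase hχm hχK
  have hB := spectralBounds_phase (ebar := ebar) hv hvp hχm hχp hχK hC₀ htr
  have hS : ∀ a, IsTVBound (indic3 η₁ η₂ η₃ χ a) (![S₁, S₂, S₃] a) := fun a => by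
    fin_cases a
    · exact hS₁
    · exact hS₂
    · exact hS₃
  have hSsum : ∑ a, ![S₁, S₂, S₃] a = S₁ + S₂ + S₃ := by simp [Fin.sum_univ_three]
  have hSε : 0 ≤ ε * (S₁ + S₂ + S₃) :=
    mul_nonneg hε.le (add_nonneg (add_nonneg hS₁.nonneg hS₂.nonneg) hS₃.nonneg)
  have henergy : (∫ x in cube3, ∑ i : Fin 3, ∑ j : Fin 3,
      (symGrad3 (fun x => vec3 ((ebar + s).mulVec fun i => x i) + v x) x i j - χ x i j) ^ 2) =
      ∑' k, energySpec ebar v χ k := by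
    rw [(hasSum_energySpec hv hb).tsum_eq]
    refine integral_congr_ae ?_
    filter_upwards [ae_restrict_of_ae (symGrad3_add_ae hv hsymm hs)] with x hx
    simp only [hx, strainError]
  rw [henergy]
  set E := ∑' k, energySpec ebar v χ k with hE
  have hE0 : 0 ≤ E := tsum_nonneg energySpec_nonneg
  refine subexp_lower_bound hQ1 hD1 hd0 hν.1 hε hε0 (T := specTail (phaseSpec χ))
    (fun a b hab => hB.specTail_anti hab) ?_ (add_nonneg hE0 hSε) (fun a b ha hab => ?_) ?_
  · have h := specTail_le_perimeter hinj hχm hχp hχK hS (inv_pos.2 hε)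
    rw [inv_inv, hSsum, ← hW] at h
    nlinarith [mul_nonneg hW0 hE0]
  · refine (hB.specTail_le ha hab).trans (mul_le_mul_of_nonneg_left ?_ (by linarith))
    have : (b / a) ^ 4 * E ≤ (b / a) ^ 4 * (E + ε * (S₁ + S₂ + S₃)) :=
      mul_le_mul_of_nonneg_left (by linarith) (by positivity)
    linarith
  · have := le_specTail_one_add (ebar := ebar) hv hvp hχm hχK hd
    linarith
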